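/- arXiv:1511.01076 — 3 statements merged into one kernel-verified Lean document; each statement's English description precedes it below -/
import Mathlib

section
/- For every finite system 𝔍 of 2-intervals, the transversal number satisfies τ(𝔍) ≤ 2ν(𝔍), where ν(𝔍) is the packing number. -/
/-- A 2-interval: a nonempty subset of `L₁ ⊔ L₂` (two disjoint copies of ℝ,
indexed by `Bool`) whose intersection with each copy is empty or a closed
bounded interval. -/
def IsTwoInterval (I : Set (Bool × ℝ)) : Prop :=
  I.Nonempty ∧ ∀ b : Bool,
    {x : ℝ | (b, x) ∈ I} = ∅ ∨
    ∃ a c : ℝ, a ≤ c ∧ {x : ℝ | (b, x) ∈ I} = Set.Icc a c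

namespace TwoInt

section Scarf
set_option linter.unusedSectionVars false
variable {T ι : Type} [Fintype T] [DecidableEq T] [Fintype ι] [DecidableEq ι]

/-- `(σ, C)` is dominant: every point is below all of `σ` in one of the orders of `C`. -/
def Dom (r : ι → T → ℕ) (σ : Finset T) (C : Finset ι) : Prop :=
  ∀ y, ∃ i ∈ C, ∀ x ∈ σ, r i y ≤ r i x

/-- Incidence of a door with a room. -/
def Adj (d R : Finset T × Finset ι) : Prop :=
  (d.2 = R.2 ∧ ∃ x, x ∉ d.1 ∧ R.1 = insert x d.1) ∨
  (d.1 = R.1 ∧ ∃ i, i ∉ R.2 ∧ d.2 = insert i R.2)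

/-- Doors of type `i0`. -/
def Typed (c : T → ι) (i0 : ι) (d : Finset T × Finset ι) : Prop :=
  d.2 = insert i0 (d.1.image c) ∧ d.2.card = d.1.card + 1

/-- In a room an element is the minimum for at most one index. -/
lemma room_inj (r : ι → T → ℕ) (hr : ∀ i, Function.Injective (r i))
    {σ : Finset T} {C : Finset ι} (hD : Dom r σ C) (hc : σ.card = C.card) {i j : ι}
    (hi : i ∈ C) (hj : j ∈ C) {x : T} (hx : x ∈ σ) (hxi : ∀ x' ∈ σ, r i x ≤ r i x')
    (hxj : ∀ x' ∈ σ, r j x ≤ r j x') : i = j := by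
  by_contra hne
  have hsurj : ∀ y ∈ σ, ∃ k ∈ C.erase i, ∀ x' ∈ σ, r k y ≤ r k x' := by
    intro y hy
    obtain ⟨k, hk, hmin⟩ := hD y
    by_cases hki : k = i
    · subst hki
      have : y = x := hr k (le_antisymm (hmin x hx) (hxi y hy))
      subst this
      exact ⟨j, Finset.mem_erase.2 ⟨fun h => hne h.symm, hj⟩, hxj⟩
    · exact ⟨k, Finset.mem_erase.2 ⟨hki, hk⟩, hmin⟩
  have : Nonempty ι := ⟨i⟩
  choose! f hf hfm using hsurj
  have hle : σ.card ≤ (C.erase i).card := by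
    apply Finset.card_le_card_of_injOn f
    · intro y hy
      exact hf y hy
    · intro y hy z hz hyz
      have h1 := hfm y hy z hz
      have h2 := hfm z hz y hy
      rw [← hyz] at h2
      exact hr _ (le_antisymm h1 h2)
  rw [Finset.card_erase_of_mem hi] at hle
  have : 0 < C.card := Finset.card_pos.2 ⟨i, hi⟩
  omega

/-- Rooms through the door `(σ, C)` associated with the index `a`. -/
def Through (r : ι → T → ℕ) (σ : Finset T) (C : Finset ι) (a : ι)
    (R : Finset T × Finset ι) : Prop :=
  Dom r R.1 R.2 ∧ (R = (σ, C.erase a) ∨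
    ∃ y, y ∉ σ ∧ R = (insert y σ, C) ∧ ∀ x ∈ σ, r a y ≤ r a x)

lemma through_exists (r : ι → T → ℕ) (hr : ∀ i, Function.Injective (r i))
    {σ : Finset T} {C : Finset ι} (hD : Dom r σ C) {i j : ι}
    (hne : i ≠ j) (hj : j ∈ C) {m : T} (hm : m ∈ σ)
    (hmi : ∀ x' ∈ σ, r i m ≤ r i x') (hmj : ∀ x' ∈ σ, r j m ≤ r j x') :
    ∃ R, Through r σ C i R := by
  by_cases h : Dom r σ (C.erase i)
  · exact ⟨_, h, Or.inl rfl⟩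
  classical
  let M : Finset T := Finset.univ.filter fun y => ∀ k ∈ C.erase i, ∃ x ∈ σ, r k x < r k y
  have hM : M.Nonempty := by
    unfold Dom at h
    push Not at h
    obtain ⟨y, hy⟩ := h
    exact ⟨y, by simpa [M] using hy⟩
  obtain ⟨y, hyM, hymax⟩ := M.exists_max_image (r i) hM
  have hy : ∀ k ∈ C.erase i, ∃ x ∈ σ, r k x < r k y := (Finset.mem_filter.1 hyM).2
  have hyσ : y ∉ σ := by
    intro hyσ
    obtain ⟨k, hk, hmin⟩ := hD y
    by_cases hki : k = i
    · subst hki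
      have : y = m := hr k (le_antisymm (hmin m hm) (hmi y hyσ))
      subst this
      obtain ⟨x, hx, hlt⟩ := hy j (Finset.mem_erase.2 ⟨fun h => hne h.symm, hj⟩)
      exact absurd (hmj x hx) (by omega)
    · obtain ⟨x, hx, hlt⟩ := hy k (Finset.mem_erase.2 ⟨hki, hk⟩)
      exact absurd (hmin x hx) (by omega)
  have hyi : i ∈ C ∧ ∀ x ∈ σ, r i y ≤ r i x := by
    obtain ⟨k, hk, hmin⟩ := hD y
    by_cases hki : k = i
    · subst hki
      exact ⟨hk, hmin⟩
    · obtain ⟨x, hx, hlt⟩ := hy k (Finset.mem_erase.2 ⟨hki, hk⟩)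
      exact absurd (hmin x hx) (by omega)
  refine ⟨(insert y σ, C), ?_, Or.inr ⟨y, hyσ, rfl, hyi.2⟩⟩
  intro y'
  by_cases hy' : y' ∈ M
  · refine ⟨i, hyi.1, ?_⟩
    intro x hx
    rcases Finset.mem_insert.1 hx with rfl | hx
    · exact hymax _ hy'
    · exact (hymax _ hy').trans (hyi.2 x hx)
  · have : ∃ k ∈ C.erase i, ∀ x ∈ σ, r k y' ≤ r k x := by
      by_contra hcon
      push Not at hcon
      exact hy' (by simpa [M] using hcon)
    obtain ⟨k, hk, hmin⟩ := this
    refine ⟨k, (Finset.mem_erase.1 hk).2, ?_⟩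
    intro x hx
    rcases Finset.mem_insert.1 hx with rfl | hx
    · obtain ⟨z, hz, hlt⟩ := hy k hk
      exact (hmin z hz).trans hlt.le
    · exact hmin x hx

lemma through_unique (r : ι → T → ℕ) (hr : ∀ i, Function.Injective (r i))
    {σ : Finset T} {C : Finset ι} (hc : C.card = σ.card + 1) {i : ι} (hi : i ∈ C)
    {R R' : Finset T × Finset ι}
    (hR : Through r σ C i R) (hR' : Through r σ C i R') : R = R' := by
  have key : ∀ y y' : T, y ∉ σ → Dom r (insert y σ) C → (∀ x ∈ σ, r i y ≤ r i x) →
      ∀ k ∈ C, (∀ x ∈ σ, r k y ≤ r k x) → k = i := by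
    intro y y' hy hDy hmin k hk hmin'
    refine room_inj r hr hDy (by rw [Finset.card_insert_of_notMem hy, hc]) hk hi
      (Finset.mem_insert_self y σ) ?_ ?_
    · intro x hx
      rcases Finset.mem_insert.1 hx with rfl | hx
      · exact le_rfl
      · exact hmin' x hx
    · intro x hx
      rcases Finset.mem_insert.1 hx with rfl | hx
      · exact le_rfl
      · exact hmin x hx
  obtain ⟨hD, h⟩ := hR
  obtain ⟨hD', h'⟩ := hR'
  rcases h with rfl | ⟨y, hy, rfl, hmin⟩ <;> rcases h' with rfl | ⟨y', hy', rfl, hmin'⟩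
  · rfl
  · exfalso
    obtain ⟨k, hk, hm⟩ := hD y'
    have := key y' y' hy' hD' hmin' k (Finset.mem_erase.1 hk).2 hm
    exact (Finset.mem_erase.1 hk).1 this
  · exfalso
    obtain ⟨k, hk, hm⟩ := hD' y
    have := key y y hy hD hmin k (Finset.mem_erase.1 hk).2 hm
    exact (Finset.mem_erase.1 hk).1 this
  · obtain ⟨k, hk, hm⟩ := hD y'
    obtain ⟨k', hk', hm'⟩ := hD' y
    have e1 := key y' y' hy' hD' hmin' k hk (fun x hx => hm x (Finset.mem_insert_of_mem hx))
    have e2 := key y y hy hD hmin k' hk' (fun x hx => hm' x (Finset.mem_insert_of_mem hx))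
    subst e1
    subst e2
    have : y = y' := hr _ (le_antisymm (hm' y' (Finset.mem_insert_self _ _))
      (hm y (Finset.mem_insert_self _ _)))
    rw [this]

lemma door_two (r : ι → T → ℕ) (hr : ∀ i, Function.Injective (r i))
    {σ : Finset T} {C : Finset ι} (hD : Dom r σ C) (hc : C.card = σ.card + 1)
    (hσ : σ.Nonempty) :
    ∃ R R' : Finset T × Finset ι, R ≠ R' ∧ ∀ Q : Finset T × Finset ι,
      ((Dom r Q.1 Q.2 ∧ Q.1.card = Q.2.card) ∧ Adj (σ, C) Q) ↔ (Q = R ∨ Q = R') := by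
  have hmin : ∀ i, ∃ m ∈ σ, ∀ x ∈ σ, r i m ≤ r i x := fun i => σ.exists_min_image (r i) hσ
  choose m hm hmm using hmin
  obtain ⟨i, hi, j, hj, hne, hij⟩ := Finset.exists_ne_map_eq_of_card_lt_of_maps_to
    (s := C) (t := σ) (by omega) (f := m) (fun i _ => hm i)
  have hmj : ∀ x ∈ σ, r j (m i) ≤ r j x := by rw [hij]; exact hmm j
  obtain ⟨R, hR⟩ := through_exists r hr hD hne hj (hm i) (hmm i) hmj
  obtain ⟨R', hR'⟩ := through_exists r hr hD hne.symm hi (hm i) hmj (hmm i)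
  have hroom : ∀ a ∈ C, ∀ Q, Through r σ C a Q →
      ((Dom r Q.1 Q.2 ∧ Q.1.card = Q.2.card) ∧ Adj (σ, C) Q) := by
    rintro a ha Q ⟨hQ, rfl | ⟨y, hy, rfl, hmin⟩⟩
    · refine ⟨⟨hQ, ?_⟩, Or.inr ⟨rfl, a, ?_, ?_⟩⟩
      · simp only [Finset.card_erase_of_mem ha]; omega
      · simp
      · simp [Finset.insert_erase ha]
    · refine ⟨⟨hQ, ?_⟩, Or.inl ⟨rfl, y, hy, rfl⟩⟩
      simp only [Finset.card_insert_of_notMem hy]; omega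
  refine ⟨R, R', ?_, ?_⟩
  · rintro rfl
    obtain ⟨hQ, h⟩ := hR
    obtain ⟨-, h'⟩ := hR'
    rcases h with rfl | ⟨y, hy, rfl, hmin⟩ <;> rcases h' with h' | ⟨y', hy', h', hmin'⟩
    · have := (Prod.ext_iff.1 h').2
      simp only at this
      have h1 : j ∈ C.erase i := Finset.mem_erase.2 ⟨hne.symm, hj⟩
      rw [this] at h1
      simp at h1
    · have := (Prod.ext_iff.1 h').2
      simp only at this
      rw [← this] at hi
      simp at hi
    · have := (Prod.ext_iff.1 h').2
      simp only at this
      rw [this] at hj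
      simp at hj
    · have h2 := (Prod.ext_iff.1 h').1
      simp only at h2
      have : y' = y := by
        have : y' ∈ insert y σ := by rw [h2]; exact Finset.mem_insert_self _ _
        rcases Finset.mem_insert.1 this with h | h
        · exact h
        · exact absurd h hy'
      subst this
      refine hne (room_inj r hr hQ (by simp only [Finset.card_insert_of_notMem hy]; omega) hi hj
        (Finset.mem_insert_self y' σ) ?_ ?_)
      · intro x hx
        rcases Finset.mem_insert.1 hx with rfl | hx
        · exact le_rfl
        · exact hmin x hx
      · intro x hx
        rcases Finset.mem_insert.1 hx with rfl | hx
        · exact le_rfl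
        · exact hmin' x hx
  · intro Q
    constructor
    · rintro ⟨⟨hQ, hQc⟩, hadj⟩
      suffices Through r σ C i Q ∨ Through r σ C j Q by
        rcases this with h | h
        · exact Or.inl (through_unique r hr hc hi h hR)
        · exact Or.inr (through_unique r hr hc hj h hR')
      obtain ⟨Q1, Q2⟩ := Q
      rcases hadj with ⟨h2, y, hy, h1⟩ | ⟨h1, a, ha, h2⟩
      · simp only at h1 h2 hy hQ hQc
        subst h1 h2
        by_contra hcon
        push Not at hcon
        have hi' : ¬ ∀ x ∈ σ, r i y ≤ r i x := fun h => hcon.1 ⟨hQ, Or.inr ⟨y, hy, rfl, h⟩⟩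
        have hj' : ¬ ∀ x ∈ σ, r j y ≤ r j x := fun h => hcon.2 ⟨hQ, Or.inr ⟨y, hy, rfl, h⟩⟩
        push Not at hi' hj'
        obtain ⟨x, hx, hxi⟩ := hi'
        obtain ⟨x', hx', hxj⟩ := hj'
        refine hne (room_inj r hr hQ hQc hi hj (Finset.mem_insert_of_mem (hm i)) ?_ ?_)
        · intro z hz
          rcases Finset.mem_insert.1 hz with rfl | hz
          · exact (hmm i x hx).trans hxi.le
          · exact hmm i z hz
        · intro z hz
          rcases Finset.mem_insert.1 hz with rfl | hz
          · exact (hmj x' hx').trans hxj.le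
          · exact hmj z hz
      · simp only at h1 h2 ha hQ hQc
        subst h1 h2
        by_cases hai : a = i
        · subst hai
          exact Or.inl ⟨hQ, Or.inl (by simp [Finset.erase_insert ha])⟩
        by_cases haj : a = j
        · subst haj
          exact Or.inr ⟨hQ, Or.inl (by simp [Finset.erase_insert ha])⟩
        exfalso
        have hi' : i ∈ Q2 := (Finset.mem_insert.1 hi).resolve_left (fun h => hai h.symm)
        have hj' : j ∈ Q2 := (Finset.mem_insert.1 hj).resolve_left (fun h => haj h.symm)
        exact hne (room_inj r hr hQ hQc hi' hj' (hm i) (hmm i) hmj)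
    · rintro (rfl | rfl)
      · exact hroom i hi _ hR
      · exact hroom j hj _ hR'

lemma door_outer [Nonempty T] (r : ι → T → ℕ) (hr : ∀ i, Function.Injective (r i)) (i0 : ι) :
    ∃ R : Finset T × Finset ι, ∀ Q : Finset T × Finset ι,
      ((Dom r Q.1 Q.2 ∧ Q.1.card = Q.2.card) ∧ Adj (∅, {i0}) Q) ↔ Q = R := by
  obtain ⟨t, -, ht⟩ := (Finset.univ : Finset T).exists_max_image (r i0) Finset.univ_nonempty
  refine ⟨({t}, {i0}), ?_⟩
  rintro ⟨Q1, Q2⟩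
  constructor
  · rintro ⟨⟨hQ, hQc⟩, hadj⟩
    rcases hadj with ⟨h2, y, hy, h1⟩ | ⟨h1, a, ha, h2⟩
    · simp only at h1 h2 hQ hQc
      subst h1 h2
      obtain ⟨k, hk, hmin⟩ := hQ t
      have hk' : k = i0 := by simpa using hk
      subst hk'
      have : y = t := hr k (le_antisymm (ht y (Finset.mem_univ _)) (hmin y (by simp)))
      subst this
      rfl
    · simp only at h1 h2 hQ hQc
      subst h1
      have : Q2 = ∅ := by
        apply Finset.card_eq_zero.1
        simpa using hQc.symm
      subst this
      obtain ⟨k, hk, -⟩ := hQ t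
      simp at hk
  · intro h
    obtain ⟨rfl, rfl⟩ := Prod.ext_iff.1 h
    refine ⟨⟨?_, by simp⟩, Or.inl ⟨rfl, t, by simp, by simp⟩⟩
    intro y
    exact ⟨i0, by simp, by simpa using ht y⟩

lemma room_two_aux (c : T → ι) (i0 : ι) {σ : Finset T} {C : Finset ι}
    (hc : σ.card = C.card) (hcol : C ≠ σ.image c) (i : ι) (hi : i ∉ C)
    (hK : insert i C = insert i0 (σ.image c)) :
    ∃ d d' : Finset T × Finset ι, d ≠ d' ∧ ∀ e : Finset T × Finset ι,
      (Typed c i0 e ∧ Adj e (σ, C)) ↔ (e = d ∨ e = d') := by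
  have hcard : (insert i0 (σ.image c)).card = σ.card + 1 := by
    rw [← hK, Finset.card_insert_of_notMem hi, hc]
  have hle : (σ.image c).card ≤ σ.card := Finset.card_image_le
  have h0 : i0 ∉ σ.image c := by
    intro h
    rw [Finset.insert_eq_self.2 h] at hcard
    omega
  rw [Finset.card_insert_of_notMem h0] at hcard
  have hinj : Set.InjOn c σ := Finset.card_image_iff.1 (by omega)
  have hne : i ≠ i0 := by
    rintro rfl
    apply hcol
    rw [← Finset.erase_insert hi, hK, Finset.erase_insert h0]
  have hi' : i ∈ σ.image c := by
    have : i ∈ insert i0 (σ.image c) := by rw [← hK]; simp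
    exact (Finset.mem_insert.1 this).resolve_left hne
  obtain ⟨x, hx, hxi⟩ := Finset.mem_image.1 hi'
  have hC : C = insert i0 ((σ.erase x).image c) := by
    rw [← Finset.erase_insert hi, hK, Finset.erase_insert_of_ne hne.symm]
    congr 1
    ext k
    simp only [Finset.mem_erase, Finset.mem_image]
    constructor
    · rintro ⟨hk, y, hy, rfl⟩
      exact ⟨y, ⟨fun h => hk (by rw [h, hxi]), hy⟩, rfl⟩
    · rintro ⟨y, ⟨hyx, hy⟩, rfl⟩
      refine ⟨fun h => hyx (hinj hy hx (by rw [h, hxi])), y, hy, rfl⟩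
  have hpos : 0 < σ.card := Finset.card_pos.2 ⟨x, hx⟩
  refine ⟨(σ, insert i C), (σ.erase x, C), ?_, ?_⟩
  · intro h
    have := (Prod.ext_iff.1 h).2
    simp only at this
    exact hi (by rw [← this]; simp)
  rintro ⟨e1, e2⟩
  constructor
  · rintro ⟨⟨ht1, ht2⟩, ⟨h2, y, hy, h1⟩ | ⟨h1, a, ha, h2⟩⟩
    · right
      simp only at ht1 ht2 h1 h2 hy
      subst h2
      have hxe : x ∉ e1 := by
        intro hxe
        apply hi
        rw [ht1]
        exact Finset.mem_insert_of_mem (Finset.mem_image.2 ⟨x, hxe, hxi⟩)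
      have : x = y := by
        rw [h1] at hx
        exact (Finset.mem_insert.1 hx).resolve_right hxe
      subst this
      rw [h1, Finset.erase_insert hy]
    · left
      simp only at ht1 ht2 h1 h2 ha
      subst h1
      rw [ht1, hK]
  · rintro (h | h)
    · rw [h]
      refine ⟨⟨hK, ?_⟩, Or.inr ⟨rfl, i, hi, rfl⟩⟩
      simp only [Finset.card_insert_of_notMem hi]
      omega
    · rw [h]
      refine ⟨⟨hC, ?_⟩, Or.inl ⟨rfl, x, by simp, by simp [Finset.insert_erase hx]⟩⟩
      simp only [Finset.card_erase_of_mem hx]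
      omega

lemma room_two (c : T → ι) (i0 : ι) {σ : Finset T} {C : Finset ι}
    (hc : σ.card = C.card) (hcol : C ≠ σ.image c) (d : Finset T × Finset ι)
    (hd : Typed c i0 d) (hadj : Adj d (σ, C)) :
    ∃ d d' : Finset T × Finset ι, d ≠ d' ∧ ∀ e : Finset T × Finset ι,
      (Typed c i0 e ∧ Adj e (σ, C)) ↔ (e = d ∨ e = d') := by
  obtain ⟨τ, K⟩ := d
  obtain ⟨hd1, hd2⟩ := hd
  rcases hadj with ⟨h2, x, hx, h1⟩ | ⟨h1, i, hi, h2⟩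
  · simp only at h1 h2 hd1 hd2 hx
    subst h2
    by_cases hxK : c x ∈ K
    · have hle : (τ.image c).card ≤ τ.card := Finset.card_image_le
      have h0 : i0 ∉ τ.image c := by
        intro h
        rw [Finset.insert_eq_self.2 h] at hd1
        rw [hd1] at hd2
        omega
      have hinj : Set.InjOn c τ := by
        apply Finset.card_image_iff.1
        rw [hd1, Finset.card_insert_of_notMem h0] at hd2
        omega
      have hx0 : c x ≠ i0 := by
        intro h
        apply hcol
        rw [h1, Finset.image_insert, h, hd1]
      have : c x ∈ τ.image c := by
        rw [hd1] at hxK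
        exact (Finset.mem_insert.1 hxK).resolve_left hx0
      obtain ⟨x', hx', hxx'⟩ := Finset.mem_image.1 this
      have hnex : x ≠ x' := fun h => hx (h ▸ hx')
      have hxσ : x ∈ σ := by rw [h1]; simp
      have hx'σ : x' ∈ σ := by rw [h1]; exact Finset.mem_insert_of_mem hx'
      have hτ : τ = σ.erase x := by rw [h1, Finset.erase_insert hx]
      have himg : (σ.erase x').image c = τ.image c := by
        rw [h1]
        ext k
        simp only [Finset.mem_erase, Finset.mem_image, Finset.mem_insert]
        constructor
        · rintro ⟨y, ⟨hy1, rfl | hy2⟩, rfl⟩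
          · exact ⟨x', hx', hxx'⟩
          · exact ⟨y, hy2, rfl⟩
        · rintro ⟨y, hy, rfl⟩
          by_cases hyx : y = x'
          · exact ⟨x, ⟨hnex, Or.inl rfl⟩, by rw [hyx, hxx']⟩
          · exact ⟨y, ⟨hyx, Or.inr hy⟩, rfl⟩
      have hpos : 0 < σ.card := Finset.card_pos.2 ⟨x, hxσ⟩
      refine ⟨(σ.erase x, K), (σ.erase x', K), ?_, ?_⟩
      · intro h
        have := (Prod.ext_iff.1 h).1
        simp only at this
        have h3 : x ∈ σ.erase x' := Finset.mem_erase.2 ⟨hnex, hxσ⟩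
        rw [← this] at h3
        simp at h3
      rintro ⟨e1, e2⟩
      constructor
      · rintro ⟨⟨ht1, ht2⟩, ⟨g2, y, hy, g1⟩ | ⟨g1, a, ha, g2⟩⟩
        · simp only at ht1 ht2 g1 g2 hy
          subst g2
          have hy' : y = x ∨ y = x' := by
            by_contra hcon
            push Not at hcon
            have hxe : x ∈ e1 := by
              rw [g1] at hxσ
              exact (Finset.mem_insert.1 hxσ).resolve_left hcon.1.symm
            have hxe' : x' ∈ e1 := by
              rw [g1] at hx'σ
              exact (Finset.mem_insert.1 hx'σ).resolve_left hcon.2.symm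
            have hle' : (e1.image c).card ≤ e1.card := Finset.card_image_le
            have hle2 := Finset.card_insert_le i0 (e1.image c)
            rw [← ht1] at hle2
            have hinj' : Set.InjOn c e1 := Finset.card_image_iff.1 (by omega)
            exact hnex (hinj' hxe hxe' hxx'.symm)
          have he : e1 = σ.erase y := by rw [g1, Finset.erase_insert hy]
          rcases hy' with rfl | rfl
          · left; rw [he]
          · right; rw [he]
        · exfalso
          simp only at ht1 ht2 g1 g2 ha
          subst g1
          have : e2 = K := by
            rw [ht1, h1, Finset.image_insert, Finset.insert_comm, ← hd1,
              Finset.insert_eq_self.2 hxK]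
          rw [this] at ht2
          omega
      · rintro (h | h)
        · rw [h]
          refine ⟨⟨by simp only; rw [← hτ, hd1], ?_⟩,
            Or.inl ⟨rfl, x, by simp, by simp [Finset.insert_erase hxσ]⟩⟩
          simp only [Finset.card_erase_of_mem hxσ]
          omega
        · rw [h]
          refine ⟨⟨by simp only; rw [himg, hd1], ?_⟩,
            Or.inl ⟨rfl, x', by simp, by simp [Finset.insert_erase hx'σ]⟩⟩
          simp only [Finset.card_erase_of_mem hx'σ]
          omega
    · apply room_two_aux c i0 hc hcol (c x) hxK
      rw [h1, Finset.image_insert, Finset.insert_comm, ← hd1]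
  · simp only at h1 h2 hd1 hd2 hi
    subst h1
    exact room_two_aux c i0 hc hcol i hi (by rw [← h2, hd1])

/-- Scarf-type colourful cell lemma. -/
lemma exists_colorful [Nonempty T] [Nonempty ι] (r : ι → T → ℕ)
    (hr : ∀ i, Function.Injective (r i)) (c : T → ι) :
    ∃ (σ : Finset T) (C : Finset ι), Dom r σ C ∧ C = σ.image c := by
  classical
  obtain ⟨i0⟩ := ‹Nonempty ι›
  by_contra hcon
  push Not at hcon
  let Rooms : Finset (Finset T × Finset ι) :=
    Finset.univ.filter fun R => Dom r R.1 R.2 ∧ R.1.card = R.2.card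
  let Doors : Finset (Finset T × Finset ι) :=
    Finset.univ.filter fun d => Dom r d.1 d.2 ∧ Typed c i0 d
  have hcount := Finset.sum_card_bipartiteAbove_eq_sum_card_bipartiteBelow
    (s := Doors) (t := Rooms) Adj
  have hrooms : Even (∑ R ∈ Rooms, (Finset.bipartiteBelow Adj Doors R).card) := by
    apply Finset.even_sum
    intro R hR
    obtain ⟨-, hRD, hRc⟩ := Finset.mem_filter.1 hR
    rcases (Finset.bipartiteBelow Adj Doors R).eq_empty_or_nonempty with h | ⟨d, hd⟩
    · rw [h]; simp
    · obtain ⟨hd1, hd2⟩ := Finset.mem_filter.1 hd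
      obtain ⟨-, hdD, hdt⟩ := Finset.mem_filter.1 hd1
      obtain ⟨e, e', hne, hiff⟩ := room_two c i0 hRc (hcon R.1 R.2 hRD) d hdt hd2
      have : Finset.bipartiteBelow Adj Doors R = {e, e'} := by
        ext q
        rw [Finset.mem_insert, Finset.mem_singleton, ← hiff q, Finset.mem_bipartiteBelow,
          Finset.mem_filter]
        constructor
        · rintro ⟨⟨-, -, h1⟩, h2⟩
          exact ⟨h1, h2⟩
        · rintro ⟨h1, h2⟩
          refine ⟨⟨Finset.mem_univ _, ?_, h1⟩, h2⟩
          intro y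
          obtain ⟨k, hk, hmin⟩ := hRD y
          rcases h2 with ⟨g2, x, hx, g1⟩ | ⟨g1, a, ha, g2⟩
          · refine ⟨k, by rw [g2]; exact hk, fun z hz => hmin z ?_⟩
            simp only at g1
            rw [g1]
            exact Finset.mem_insert_of_mem hz
          · refine ⟨k, by rw [g2]; exact Finset.mem_insert_of_mem hk, fun z hz => hmin z ?_⟩
            simp only at g1
            rw [← g1]
            exact hz
      rw [this, Finset.card_pair hne]
      exact even_two
  have hout : (∅, {i0}) ∈ Doors := by
    refine Finset.mem_filter.2 ⟨Finset.mem_univ _, ?_, ?_⟩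
    · intro y
      exact ⟨i0, by simp, by simp⟩
    · exact ⟨by simp, by simp⟩
  have hdoors : Odd (∑ d ∈ Doors, (Finset.bipartiteAbove Adj Rooms d).card) := by
    rw [← Finset.add_sum_erase _ _ hout]
    apply Odd.add_even
    · obtain ⟨R, hR⟩ := door_outer r hr i0
      have : Finset.bipartiteAbove Adj Rooms ((∅, {i0}) : Finset T × Finset ι) = {R} := by
        ext Q
        rw [Finset.mem_singleton, ← hR Q, Finset.mem_bipartiteAbove, Finset.mem_filter]
        simp
      rw [this]
      simp
    · apply Finset.even_sum
      rintro ⟨σ, C⟩ hd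
      obtain ⟨hne, hd⟩ := Finset.mem_erase.1 hd
      obtain ⟨-, hD, ht1, ht2⟩ := Finset.mem_filter.1 hd
      simp only at hD ht1 ht2
      have hσ : σ.Nonempty := by
        rw [Finset.nonempty_iff_ne_empty]
        rintro rfl
        apply hne
        rw [ht1]
        simp
      obtain ⟨R, R', hRR, hR⟩ := door_two r hr hD ht2 hσ
      have : Finset.bipartiteAbove Adj Rooms (σ, C) = {R, R'} := by
        ext Q
        rw [Finset.mem_insert, Finset.mem_singleton, ← hR Q, Finset.mem_bipartiteAbove, Finset.mem_filter]
        simp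
      rw [this, Finset.card_pair hRR]
      exact even_two
  rw [hcount] at hdoors
  exact (Nat.not_odd_iff_even.2 hrooms) hdoors

end Scarf
end TwoInt
namespace TwoInt

section Brouwer
variable {ι : Type} [Fintype ι] [DecidableEq ι]

lemma grid_colorful [Nonempty ι] (N : ℕ) (c : (ι → ℕ) → ι) :
    ∃ (C : Finset ι) (p : ι → ι → ℕ), C.Nonempty ∧
      (∀ i ∈ C, ∑ k, p i k = N ∧ c (p i) = i) ∧
      (∀ i ∈ C, ∀ j ∈ C, ∀ k, p i k ≤ p j k + Fintype.card ι) ∧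
      (∀ i ∈ C, ∀ k ∉ C, p i k ≤ Fintype.card ι) := by
  classical
  let T := {a : ι → Fin (N + 1) // ∑ i, (a i : ℕ) = N}
  have mkT : ∀ b : ι → ℕ, ∑ i, b i = N → ∃ t : T, ∀ i, (t.1 i : ℕ) = b i := by
    intro b hb
    have hle : ∀ i, b i < N + 1 := by
      intro i
      have := Finset.single_le_sum (f := b) (fun j _ => Nat.zero_le _) (Finset.mem_univ i)
      omega
    exact ⟨⟨fun i => ⟨b i, hle i⟩, hb⟩, fun i => rfl⟩
  have hTne : Nonempty T := by
    obtain ⟨i⟩ := ‹Nonempty ι›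
    obtain ⟨t, -⟩ := mkT (Pi.single i N) (by simp)
    exact ⟨t⟩
  let e := Fintype.equivFin T
  let M := Fintype.card T
  let r : ι → T → ℕ := fun i t => (t.1 i : ℕ) * M + (e t : ℕ)
  have hrle : ∀ i t t', r i t ≤ r i t' → (t.1 i : ℕ) ≤ t'.1 i := by
    intro i t t' h
    by_contra hlt
    push Not at hlt
    have h1 : ((t'.1 i : ℕ) + 1) * M ≤ (t.1 i : ℕ) * M := Nat.mul_le_mul_right M hlt
    have h2 : (e t' : ℕ) < M := (e t').2
    simp only [r] at h
    rw [add_mul] at h1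
    omega
  have hr : ∀ i, Function.Injective (r i) := by
    intro i t t' h
    have h1 := hrle i t t' h.le
    have h2 := hrle i t' t h.ge
    have h3 := le_antisymm h1 h2
    simp only [r, h3] at h
    exact e.injective (Fin.ext (by omega))
  obtain ⟨σ, C, hD, hC⟩ := exists_colorful r hr (fun t : T => c (fun k => (t.1 k : ℕ)))
  have hCne : C.Nonempty := by
    obtain ⟨t⟩ := hTne
    obtain ⟨i, hi, -⟩ := hD t
    exact ⟨i, hi⟩
  have hσ : σ.Nonempty := by
    rw [hC] at hCne
    exact Finset.image_nonempty.1 hCne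
  have hmin : ∀ k, ∃ x ∈ σ, ∀ y ∈ σ, (x.1 k : ℕ) ≤ y.1 k := fun k =>
    σ.exists_min_image (fun x => (x.1 k : ℕ)) hσ
  choose mx hmx hmxle using hmin
  let m : ι → ℕ := fun k => (mx k).1 k
  have hsum : N < ∑ k ∈ C, (m k + 1) := by
    by_contra hcon
    push Not at hcon
    obtain ⟨i0, hi0⟩ := hCne
    let b : ι → ℕ := fun k => (if k ∈ C then m k + 1 else 0) +
      (if k = i0 then N - ∑ k ∈ C, (m k + 1) else 0)
    have hb : ∑ k, b k = N := by
      simp only [b, Finset.sum_add_distrib, Finset.sum_ite_mem, Finset.univ_inter,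
        Finset.sum_ite_eq', Finset.mem_univ, if_true]
      rw [← Finset.sum_add_distrib]
      omega
    obtain ⟨t, ht⟩ := mkT b hb
    obtain ⟨i, hi, hmin⟩ := hD t
    have h1 := hrle i _ _ (hmin (mx i) (hmx i))
    rw [ht i] at h1
    simp only [b, hi, if_true, m] at h1
    omega
  rw [Finset.sum_add_distrib] at hsum
  have hCc : C.card ≤ Fintype.card ι := Finset.card_le_univ C
  simp only [Finset.sum_const, smul_eq_mul, mul_one] at hsum
  have hsplit : ∀ x ∈ σ, ∑ k ∈ C, ((x.1 k : ℕ) - m k) + ∑ k ∈ C, m k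
      + ∑ k ∈ Cᶜ, (x.1 k : ℕ) = N := by
    intro x hx
    refine Eq.trans ?_ x.2
    rw [← Finset.sum_add_distrib, ← Finset.sum_add_sum_compl C (fun k => (x.1 k : ℕ))]
    congr 1
    apply Finset.sum_congr rfl
    intro k _
    have := hmxle k x hx
    simp only [m]
    omega
  have hex : ∀ i ∈ C, ∃ x ∈ σ, c (fun k => (x.1 k : ℕ)) = i := by
    intro i hi
    rw [hC] at hi
    exact Finset.mem_image.1 hi
  choose! x hx hxc using hex
  refine ⟨C, fun i k => ((x i).1 k : ℕ), hCne, ?_, ?_, ?_⟩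
  · intro i hi
    exact ⟨(x i).2, hxc i hi⟩
  · intro i hi j hj k
    have h1 := hsplit (x i) (hx i hi)
    have h2 := hmxle k (x j) (hx j hj)
    by_cases hk : k ∈ C
    · have h3 := Finset.single_le_sum (f := fun k => ((x i).1 k : ℕ) - m k)
        (fun j _ => Nat.zero_le _) hk
      simp only [m] at h3 h1 hsum ⊢
      omega
    · have h3 := Finset.single_le_sum (f := fun k => ((x i).1 k : ℕ))
        (fun j _ => Nat.zero_le _) (Finset.mem_compl.2 hk)
      simp only at h3 ⊢
      omega
  · intro i hi k hk
    have h1 := hsplit (x i) (hx i hi)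
    have h3 := Finset.single_le_sum (f := fun k => ((x i).1 k : ℕ))
      (fun j _ => Nat.zero_le _) (Finset.mem_compl.2 hk)
    simp only at h3 ⊢
    omega

lemma brouwer_approx [Nonempty ι] (f : (ι → ℝ) → (ι → ℝ))
    (hf : ContinuousOn f (stdSimplex ℝ ι)) (hm : Set.MapsTo f (stdSimplex ℝ ι) (stdSimplex ℝ ι))
    (ε : ℝ) (hε : 0 < ε) : ∃ x ∈ stdSimplex ℝ ι, ∀ i, x i - ε ≤ f x i := by
  classical
  have huc := (isCompact_stdSimplex (𝕜 := ℝ) ι).uniformContinuousOn_of_continuous hf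
  rw [Metric.uniformContinuousOn_iff] at huc
  obtain ⟨δ, hδ, huc⟩ := huc (ε / 2) (by linarith)
  obtain ⟨N, hN⟩ := exists_nat_gt ((Fintype.card ι : ℝ) / min δ (ε / 2))
  have hmin : 0 < min δ (ε / 2) := lt_min hδ (by linarith)
  have hN0 : (0 : ℝ) < N := lt_of_le_of_lt (by positivity) hN
  have hsmall : (Fintype.card ι : ℝ) / N < min δ (ε / 2) := by
    rw [div_lt_iff₀ hmin] at hN
    rw [div_lt_iff₀ hN0]
    linarith
  have hs1 := lt_of_lt_of_le hsmall (min_le_left _ _)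
  have hs2 := lt_of_lt_of_le hsmall (min_le_right _ _)
  let q : (ι → ℕ) → (ι → ℝ) := fun a k => (a k : ℝ) / N
  have hq : ∀ a : ι → ℕ, ∑ k, a k = N → q a ∈ stdSimplex ℝ ι := by
    intro a ha
    refine ⟨fun k => by positivity, ?_⟩
    simp only [q]
    rw [← Finset.sum_div, ← Nat.cast_sum, ha, div_self hN0.ne']
  have hcol : ∀ a : ι → ℕ, ∃ i, ∑ k, a k = N → q a i ≤ f (q a) i := by
    intro a
    by_cases ha : ∑ k, a k = N
    · by_contra hcon
      push Not at hcon
      have h1 := (hq a ha).2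
      have h2 := (hm (hq a ha)).2
      have h3 : ∑ k, f (q a) k < ∑ k, q a k :=
        Finset.sum_lt_sum_of_nonempty Finset.univ_nonempty (fun i _ => (hcon i).2)
      linarith
    · exact ⟨Classical.arbitrary ι, fun h => absurd h ha⟩
  choose c hc using hcol
  obtain ⟨C, p, ⟨i0, hi0⟩, hp, hclose, hout⟩ := grid_colorful N c
  have hp0 := hq _ (hp i0 hi0).1
  have hclose' : ∀ i ∈ C, ∀ j ∈ C, ∀ k, q (p i) k - q (p j) k ≤ (Fintype.card ι : ℝ) / N := by
    intro i hi j hj k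
    simp only [q]
    rw [← sub_div]
    apply div_le_div_of_nonneg_right _ hN0.le
    have : (p i k : ℝ) ≤ p j k + Fintype.card ι := by exact_mod_cast hclose i hi j hj k
    linarith
  refine ⟨q (p i0), hp0, fun i => ?_⟩
  by_cases hi : i ∈ C
  · have h1 := hc (p i) (hp i hi).1
    rw [(hp i hi).2] at h1
    have hd : dist (q (p i)) (q (p i0)) < δ := by
      rw [dist_pi_lt_iff hδ]
      intro k
      rw [Real.dist_eq, abs_lt]
      have a1 := hclose' i hi i0 hi0 k
      have a2 := hclose' i0 hi0 i hi k
      constructor <;> linarith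
    have h2 := huc _ (hq _ (hp i hi).1) _ hp0 hd
    have h3 := (dist_le_pi_dist (f (q (p i))) (f (q (p i0))) i).trans_lt h2
    rw [Real.dist_eq, abs_lt] at h3
    have a2 := hclose' i0 hi0 i hi i
    linarith [h3.2]
  · have h1 := (hm hp0).1 i
    have h2 : q (p i0) i ≤ (Fintype.card ι : ℝ) / N := by
      simp only [q]
      apply div_le_div_of_nonneg_right _ hN0.le
      exact_mod_cast hout i0 hi0 i hi
    linarith

/-- Brouwer's fixed point theorem for the standard simplex. -/
theorem brouwer_simplex [Nonempty ι] (f : (ι → ℝ) → (ι → ℝ))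
    (hf : ContinuousOn f (stdSimplex ℝ ι)) (hm : Set.MapsTo f (stdSimplex ℝ ι) (stdSimplex ℝ ι)) :
    ∃ x ∈ stdSimplex ℝ ι, f x = x := by
  classical
  have hne : (stdSimplex ℝ ι).Nonempty := ⟨_, single_mem_stdSimplex ℝ (Classical.arbitrary ι)⟩
  have hcont : ContinuousOn (fun x => ∑ i, max 0 (x i - f x i)) (stdSimplex ℝ ι) := by
    apply continuousOn_finsetSum
    intro i _
    have h1 : ContinuousOn (fun x => f x i) (stdSimplex ℝ ι) :=
      (continuous_apply i).comp_continuousOn hf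
    have h2 : ContinuousOn (fun x : ι → ℝ => x i) (stdSimplex ℝ ι) :=
      (continuous_apply i).continuousOn
    exact continuousOn_const.sup (h2.sub h1)
  obtain ⟨x, hx, hxmin⟩ := (isCompact_stdSimplex (𝕜 := ℝ) ι).exists_isMinOn hne hcont
  have hle : ∀ ε > 0, ∑ i, max 0 (x i - f x i) ≤ Fintype.card ι * ε := by
    intro ε hε
    obtain ⟨y, hy, hyε⟩ := brouwer_approx f hf hm ε hε
    refine (hxmin hy).trans ?_
    calc ∑ i, max 0 (y i - f y i) ≤ ∑ _i : ι, ε :=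
          Finset.sum_le_sum (fun i _ => max_le hε.le (by linarith [hyε i]))
      _ = Fintype.card ι * ε := by simp
  have hzero : ∑ i, max 0 (x i - f x i) ≤ 0 := by
    by_contra hcon
    push Not at hcon
    have hcard : (0 : ℝ) < Fintype.card ι := by exact_mod_cast Fintype.card_pos
    have := hle ((∑ i, max 0 (x i - f x i)) / (2 * Fintype.card ι)) (by positivity)
    have h2 : (Fintype.card ι : ℝ) * ((∑ i, max 0 (x i - f x i)) / (2 * Fintype.card ι))
      = (∑ i, max 0 (x i - f x i)) / 2 := by field_simp
    linarith
  have hall : ∀ i, x i ≤ f x i := by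
    intro i
    have := Finset.single_le_sum (f := fun i => max 0 (x i - f x i))
      (fun j _ => le_max_left _ _) (Finset.mem_univ i)
    have h2 := le_max_right 0 (x i - f x i)
    linarith
  refine ⟨x, hx, ?_⟩
  have hs : ∑ i, x i = ∑ i, f x i := by rw [hx.2, (hm hx).2]
  have := (Finset.sum_eq_sum_iff_of_le (fun i _ => hall i)).1 hs
  funext i
  exact (this i (Finset.mem_univ i)).symm

end Brouwer
end TwoInt
namespace TwoInt

section Product

lemma product_balance (n : ℕ) (g : Bool → (Bool → Fin (n + 1) → ℝ) → Fin (n + 1) → ℝ)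
    (hg : ∀ b k, ContinuousOn (fun z => g b z k) {z | ∀ b, z b ∈ stdSimplex ℝ (Fin (n + 1))})
    (hsum : ∀ z, (∀ b, z b ∈ stdSimplex ℝ (Fin (n + 1))) → ∀ b, ∑ k, g b z k = 1)
    (hzero : ∀ z, (∀ b, z b ∈ stdSimplex ℝ (Fin (n + 1))) → ∀ b k, z b k = 0 → g b z k = 0) :
    ∃ z, (∀ b, z b ∈ stdSimplex ℝ (Fin (n + 1))) ∧
      ∀ b k, g b z k = 1 / ((n : ℝ) + 1) := by
  have hn : (0 : ℝ) < (n : ℝ) + 1 := by positivity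
  let D : Set (Bool → Fin (n + 1) → ℝ) := {z | ∀ b, z b ∈ stdSimplex ℝ (Fin (n + 1))}
  let s : (Bool × Fin (n + 1) → ℝ) → Bool → ℝ := fun u b => ∑ k, 2 * u (b, k)
  let ρ : (Bool × Fin (n + 1) → ℝ) → Bool → Fin (n + 1) → ℝ := fun u b k =>
    (2 * u (b, k) + max 0 (1 - s u b) / (n + 1)) / max 1 (s u b)
  have hmax1 : ∀ t : ℝ, 0 < max 1 t := fun t => lt_of_lt_of_le one_pos (le_max_left _ _)
  have hρc : Continuous ρ := by
    refine continuous_pi fun b => continuous_pi fun k => ?_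
    refine Continuous.div (by fun_prop) (by fun_prop) ?_
    intro u
    exact (hmax1 _).ne'
  have hρm : ∀ u ∈ stdSimplex ℝ (Bool × Fin (n + 1)), ρ u ∈ D := by
    intro u hu b
    constructor
    · intro k
      have h1 := hu.1 (b, k)
      have h2 : 0 ≤ max 0 (1 - s u b) := le_max_left _ _
      have h3 := hmax1 (s u b)
      show 0 ≤ (2 * u (b, k) + max 0 (1 - s u b) / (n + 1)) / max 1 (s u b)
      positivity
    · show ∑ k, (2 * u (b, k) + max 0 (1 - s u b) / (n + 1)) / max 1 (s u b) = 1
      rw [← Finset.sum_div, div_eq_one_iff_eq (hmax1 _).ne', Finset.sum_add_distrib]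
      simp only [Finset.sum_const, Finset.card_univ, Fintype.card_fin, nsmul_eq_mul]
      push_cast
      rw [mul_div_cancel₀ _ hn.ne']
      show s u b + max 0 (1 - s u b) = max 1 (s u b)
      rcases le_total 1 (s u b) with h | h
      · rw [max_eq_left (by linarith), max_eq_right h]; ring
      · rw [max_eq_right (by linarith), max_eq_left h]; ring
  let e : Bool → (Bool → Fin (n + 1) → ℝ) → Fin (n + 1) → ℝ := fun b z k =>
    max 0 (1 / ((n : ℝ) + 1) - g b z k)
  have he0 : ∀ b z k, 0 ≤ e b z k := fun b z k => le_max_left _ _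
  have hes : ∀ b z, 0 ≤ ∑ k, e b z k := fun b z => Finset.sum_nonneg fun k _ => he0 b z k
  let t : (Bool → Fin (n + 1) → ℝ) → Bool → Fin (n + 1) → ℝ := fun z b k =>
    (z b k + e b z k) / (1 + ∑ j, e b z j)
  have htm : ∀ z ∈ D, t z ∈ D := by
    intro z hz b
    have h3 := hes b z
    constructor
    · intro k
      have h1 := (hz b).1 k
      have h2 := he0 b z k
      show 0 ≤ (z b k + e b z k) / (1 + ∑ j, e b z j)
      positivity
    · show ∑ k, (z b k + e b z k) / (1 + ∑ j, e b z j) = 1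
      rw [← Finset.sum_div, Finset.sum_add_distrib, (hz b).2, div_self]
      linarith
  have hec : ∀ b k, ContinuousOn (fun z => e b z k) D := fun b k =>
    continuousOn_const.sup (continuousOn_const.sub (hg b k))
  have htc : ∀ b k, ContinuousOn (fun z => t z b k) D := by
    intro b k
    refine ContinuousOn.div (ContinuousOn.add (by fun_prop) (hec b k))
      (continuousOn_const.add (continuousOn_finsetSum _ fun j _ => hec b j)) ?_
    intro z _
    have := hes b z
    positivity
  let F : (Bool × Fin (n + 1) → ℝ) → (Bool × Fin (n + 1) → ℝ) := fun u p =>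
    t (ρ u) p.1 p.2 / 2
  obtain ⟨u, hu, hfix⟩ := brouwer_simplex F
    (by
      refine continuousOn_pi.2 fun p => ?_
      exact ((htc p.1 p.2).comp hρc.continuousOn hρm).div_const 2)
    (by
      intro u hu
      have h := htm _ (hρm u hu)
      refine ⟨fun p => div_nonneg ((h p.1).1 p.2) (by norm_num), ?_⟩
      rw [Fintype.sum_prod_type, Fintype.sum_bool]
      show ∑ k, t (ρ u) true k / 2 + ∑ k, t (ρ u) false k / 2 = 1
      generalize t (ρ u) = q at h
      rw [← Finset.sum_div, ← Finset.sum_div, (h true).2, (h false).2]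
      norm_num)
  have hz := hρm u hu
  have htz := htm _ hz
  have hu2 : ∀ b k, 2 * u (b, k) = t (ρ u) b k := by
    intro b k
    have := congrFun hfix (b, k)
    simp only [F] at this
    linarith
  have hs1 : ∀ b, s u b = 1 := by
    intro b
    simp only [s, hu2]
    exact (htz b).2
  have hρu : ∀ b k, ρ u b k = t (ρ u) b k := by
    intro b k
    show (2 * u (b, k) + max 0 (1 - s u b) / (n + 1)) / max 1 (s u b) = _
    rw [hs1, hu2]
    simp
  refine ⟨ρ u, hz, ?_⟩
  intro b
  generalize ρ u = z at hz hρu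
  have hS := hes b z
  have hfx : ∀ k, z b k * ∑ j, e b z j = e b z k := by
    intro k
    have := hρu b k
    simp only [t] at this
    rw [eq_div_iff (by positivity)] at this
    linarith
  have hconst : ∑ _k : Fin (n + 1), 1 / ((n : ℝ) + 1) = 1 := by
    simp only [Finset.sum_const, Finset.card_univ, Fintype.card_fin, nsmul_eq_mul]
    push_cast
    field_simp
  have hS0 : ∑ j, e b z j = 0 := by
    by_contra hne
    have hSpos : 0 < ∑ j, e b z j := lt_of_le_of_ne hS (Ne.symm hne)
    have hzpos : ∀ k, 0 < z b k := by
      intro k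
      refine lt_of_le_of_ne ((hz b).1 k) fun h0 => ?_
      have h1 := hfx k
      rw [← h0, zero_mul] at h1
      have h2 : e b z k = 1 / ((n : ℝ) + 1) := by
        simp only [e]
        rw [hzero z hz b k h0.symm, sub_zero]
        exact max_eq_right (by positivity)
      rw [h2] at h1
      have : 0 < 1 / ((n : ℝ) + 1) := by positivity
      linarith
    have hlt : ∀ k, g b z k < 1 / ((n : ℝ) + 1) := by
      intro k
      have h1 : 0 < e b z k := by
        rw [← hfx k]
        exact mul_pos (hzpos k) hSpos
      simp only [e, lt_max_iff, lt_irrefl, false_or] at h1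
      linarith
    have : ∑ k, g b z k < ∑ _k : Fin (n + 1), 1 / ((n : ℝ) + 1) :=
      Finset.sum_lt_sum_of_nonempty Finset.univ_nonempty fun k _ => hlt k
    rw [hsum z hz b, hconst] at this
    exact lt_irrefl _ this
  have hge : ∀ k, 1 / ((n : ℝ) + 1) ≤ g b z k := by
    intro k
    have h1 : e b z k = 0 := by rw [← hfx k, hS0, mul_zero]
    have h2 : 1 / ((n : ℝ) + 1) - g b z k ≤ e b z k := le_max_right _ _
    linarith
  have := (Finset.sum_eq_sum_iff_of_le (s := Finset.univ) (fun k _ => hge k)).1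
    (by rw [hconst, hsum z hz b])
  intro k
  exact (this k (Finset.mem_univ k)).symm

lemma product_matching (n : ℕ)
    (w : (Bool → Fin (n + 1) → ℝ) → Fin (n + 1) → Fin (n + 1) → ℝ)
    (hw : ∀ k l, Continuous fun z => w z k l)
    (hnn : ∀ z k l, 0 ≤ w z k l)
    (hpos : ∀ z, (∀ b, z b ∈ stdSimplex ℝ (Fin (n + 1))) → ∃ k l, 0 < w z k l)
    (hsupp : ∀ z, (∀ b, z b ∈ stdSimplex ℝ (Fin (n + 1))) → ∀ k l, 0 < w z k l →
      0 < z false k ∧ 0 < z true l) :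
    ∃ z, (∀ b, z b ∈ stdSimplex ℝ (Fin (n + 1))) ∧
      ∃ σ : Equiv.Perm (Fin (n + 1)), ∀ k, 0 < w z k (σ k) := by
  have hn : (0 : ℝ) < (n : ℝ) + 1 := by positivity
  let tot : (Bool → Fin (n + 1) → ℝ) → ℝ := fun z => ∑ k, ∑ l, w z k l
  have htot : ∀ z, (∀ b, z b ∈ stdSimplex ℝ (Fin (n + 1))) → 0 < tot z := by
    intro z hz
    obtain ⟨k, l, hkl⟩ := hpos z hz
    refine Finset.sum_pos' (fun k _ => Finset.sum_nonneg fun l _ => hnn z k l)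
      ⟨k, Finset.mem_univ _, Finset.sum_pos' (fun l _ => hnn z k l) ⟨l, Finset.mem_univ _, hkl⟩⟩
  have hzero : ∀ z, (∀ b, z b ∈ stdSimplex ℝ (Fin (n + 1))) → ∀ k l,
      (z false k = 0 ∨ z true l = 0) → w z k l = 0 := by
    intro z hz k l h
    by_contra hne
    obtain ⟨h1, h2⟩ := hsupp z hz k l (lt_of_le_of_ne (hnn z k l) (Ne.symm hne))
    rcases h with h | h <;> linarith
  let g : Bool → (Bool → Fin (n + 1) → ℝ) → Fin (n + 1) → ℝ := fun b z k =>
    (if b = false then ∑ l, w z k l else ∑ l, w z l k) / tot z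
  obtain ⟨z, hz, hbal⟩ := product_balance n g
    (by
      intro b k
      refine ContinuousOn.div (Continuous.continuousOn ?_) (Continuous.continuousOn ?_) ?_
      · cases b
        · simpa using continuous_finsetSum _ fun l _ => hw k l
        · simpa using continuous_finsetSum _ fun l _ => hw l k
      · exact continuous_finsetSum _ fun k _ => continuous_finsetSum _ fun l _ => hw k l
      · intro z hz
        exact (htot z hz).ne')
    (by
      intro z hz b
      simp only [g]
      rw [← Finset.sum_div, div_eq_one_iff_eq (htot z hz).ne']
      cases b
      · simp [tot]
      · simp only [Bool.true_eq_false, if_false, tot]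
        exact Finset.sum_comm)
    (by
      intro z hz b k h
      simp only [g]
      rw [div_eq_zero_iff]
      left
      cases b
      · simpa using Finset.sum_eq_zero fun l _ => hzero z hz k l (Or.inl h)
      · simpa using Finset.sum_eq_zero fun l _ => hzero z hz l k (Or.inr h))
  refine ⟨z, hz, ?_⟩
  have htz := htot z hz
  have hrow : ∀ k, ∑ l, w z k l = tot z / (n + 1) := by
    intro k
    have := hbal false k
    simp only [g, if_true] at this
    rw [div_eq_div_iff htz.ne' hn.ne'] at this
    rw [eq_div_iff hn.ne']
    linarith
  have hcol : ∀ k, ∑ l, w z l k = tot z / (n + 1) := by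
    intro k
    have := hbal true k
    simp only [g, Bool.true_eq_false, if_false] at this
    rw [div_eq_div_iff htz.ne' hn.ne'] at this
    rw [eq_div_iff hn.ne']
    linarith
  let A : Matrix (Fin (n + 1)) (Fin (n + 1)) ℝ := fun k l => w z k l * ((n + 1) / tot z)
  have hA : A ∈ doublyStochastic ℝ (Fin (n + 1)) := by
    rw [mem_doublyStochastic_iff_sum]
    refine ⟨fun k l => mul_nonneg (hnn z k l) (by positivity), fun k => ?_, fun k => ?_⟩
    · simp only [A]
      rw [← Finset.sum_mul, hrow]
      field_simp
    · simp only [A]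
      rw [← Finset.sum_mul, hcol]
      field_simp
  obtain ⟨v, hv0, hv1, hvA⟩ := exists_eq_sum_perm_of_mem_doublyStochastic hA
  have hex : ∃ σ, 0 < v σ := by
    by_contra hcon
    push Not at hcon
    have : ∑ σ, v σ ≤ 0 := Finset.sum_nonpos fun σ _ => hcon σ
    linarith
  obtain ⟨σ, hσ⟩ := hex
  refine ⟨σ, fun k => ?_⟩
  have h1 : A k (σ k) = ∑ τ, v τ * (τ.permMatrix ℝ) k (σ k) := by
    rw [← hvA, Matrix.sum_apply]
    simp
  have h2 : 0 < A k (σ k) := by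
    rw [h1]
    refine Finset.sum_pos' (fun τ _ => mul_nonneg (hv0 τ) ?_) ⟨σ, Finset.mem_univ _, ?_⟩
    · simp only [Equiv.Perm.permMatrix, PEquiv.toMatrix_apply]
      split_ifs <;> norm_num
    · simpa [Equiv.Perm.permMatrix, PEquiv.toMatrix_apply] using hσ
  simp only [A] at h2
  exact pos_of_mul_pos_left h2 (by positivity)

end Product
end TwoInt
namespace TwoInt

section Core

lemma core (N n : ℕ) (l r : Bool → Fin N → ℝ) (hlr : ∀ b i, l b i ≤ r b i)
    (hν : ∀ S : Finset (Fin N),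
      (∀ i ∈ S, ∀ j ∈ S, i ≠ j → ∀ b, r b i < l b j ∨ r b j < l b i) → S.card ≤ n) :
    ∃ T : Finset (Bool × ℝ), T.card ≤ 2 * n ∧
      ∀ i, ∃ p ∈ T, l p.1 i ≤ p.2 ∧ p.2 ≤ r p.1 i := by
  classical
  by_contra hcon
  push Not at hcon
  obtain ⟨M, hM0, hM⟩ : ∃ M : ℝ, 0 < M ∧ ∀ b i, -M < l b i ∧ r b i < M := by
    refine ⟨1 + ∑ b, ∑ i, (|l b i| + |r b i|), ?_, ?_⟩
    · have : 0 ≤ ∑ b, ∑ i, (|l b i| + |r b i|) :=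
        Finset.sum_nonneg fun b _ => Finset.sum_nonneg fun i _ => by positivity
      linarith
    · intro b i
      have h1 : ∑ i, (|l b i| + |r b i|) ≤ ∑ b, ∑ i, (|l b i| + |r b i|) :=
        Finset.single_le_sum (f := fun b => ∑ i, (|l b i| + |r b i|))
          (fun b _ => Finset.sum_nonneg fun i _ => by positivity) (Finset.mem_univ b)
      have h2 : |l b i| + |r b i| ≤ ∑ i, (|l b i| + |r b i|) :=
        Finset.single_le_sum (f := fun i => (|l b i| + |r b i|))
          (fun i _ => by positivity) (Finset.mem_univ i)
      have h3 := neg_abs_le (l b i)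
      have h4 := le_abs_self (r b i)
      have h5 := abs_nonneg (l b i)
      have h6 := abs_nonneg (r b i)
      constructor <;> linarith
  let P : (Fin (n + 1) → ℝ) → ℕ → ℝ := fun z k =>
    -M + 2 * M * ∑ j ∈ Finset.univ.filter (fun j : Fin (n + 1) => (j : ℕ) < k), z j
  have hP0 : ∀ z, P z 0 = -M := by
    intro z
    simp [P]
  have hP1 : ∀ z ∈ stdSimplex ℝ (Fin (n + 1)), P z (n + 1) = M := by
    intro z hz
    have : Finset.univ.filter (fun j : Fin (n + 1) => (j : ℕ) < n + 1) = Finset.univ :=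
      Finset.filter_true_of_mem fun j _ => j.2
    simp only [P, this]
    rw [hz.2]
    ring
  have hPs : ∀ z, ∀ k : Fin (n + 1), P z (k + 1) = P z k + 2 * M * z k := by
    intro z k
    have : Finset.univ.filter (fun j : Fin (n + 1) => (j : ℕ) < k + 1) =
        insert k (Finset.univ.filter (fun j : Fin (n + 1) => (j : ℕ) < k)) := by
      ext j
      simp only [Finset.mem_filter, Finset.mem_univ, true_and, Finset.mem_insert, Fin.ext_iff]
      omega
    simp only [P, this]
    rw [Finset.sum_insert (by simp)]
    ring
  have hPm : ∀ z ∈ stdSimplex ℝ (Fin (n + 1)), Monotone (P z) := by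
    intro z hz k k' hkk
    have : ∑ j ∈ Finset.univ.filter (fun j : Fin (n + 1) => (j : ℕ) < k), z j ≤
        ∑ j ∈ Finset.univ.filter (fun j : Fin (n + 1) => (j : ℕ) < k'), z j := by
      apply Finset.sum_le_sum_of_subset_of_nonneg
      · intro j hj
        simp only [Finset.mem_filter, Finset.mem_univ, true_and] at hj ⊢
        omega
      · intro j _ _
        exact hz.1 j
    simp only [P]
    have := mul_le_mul_of_nonneg_left this (by positivity : 0 ≤ 2 * M)
    linarith
  have hPc : ∀ b k, Continuous fun z : Bool → Fin (n + 1) → ℝ => P (z b) k := by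
    intro b k
    simp only [P]
    fun_prop
  let d : Bool → Fin N → Fin (n + 1) → (Bool → Fin (n + 1) → ℝ) → ℝ := fun b i k z =>
    max 0 (min (l b i - P (z b) k) (P (z b) (k + 1) - r b i))
  have hdc : ∀ b i k, Continuous (d b i k) := fun b i k =>
    continuous_const.max ((continuous_const.sub (hPc b k)).min ((hPc b (k + 1)).sub
      continuous_const))
  have hd0 : ∀ b i k z, 0 ≤ d b i k z := fun b i k z => le_max_left _ _
  have hdpos : ∀ b i k z, 0 < d b i k z ↔ (P (z b) k < l b i ∧ r b i < P (z b) (k + 1)) := by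
    intro b i k z
    simp only [d, lt_max_iff, lt_irrefl, false_or, lt_min_iff, sub_pos]
  let w : (Bool → Fin (n + 1) → ℝ) → Fin (n + 1) → Fin (n + 1) → ℝ := fun z k k' =>
    ∑ i, d false i k z * d true i k' z
  have hwpos : ∀ z k k', 0 < w z k k' → ∃ i, 0 < d false i k z ∧ 0 < d true i k' z := by
    intro z k k' h
    by_contra hc
    push Not at hc
    have : w z k k' ≤ 0 := by
      apply Finset.sum_nonpos
      intro i _
      rcases (hd0 false i k z).eq_or_lt with h0 | h0
      · rw [← h0, zero_mul]
      · exact mul_nonpos_of_nonneg_of_nonpos (hd0 _ _ _ _) (hc i h0)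
    linarith
  obtain ⟨z, hz, σ, hσ⟩ := product_matching n w
    (fun k k' => continuous_finsetSum _ fun i _ => (hdc false i k).mul (hdc true i k'))
    (fun z k k' => Finset.sum_nonneg fun i _ => mul_nonneg (hd0 _ _ _ _) (hd0 _ _ _ _))
    (by
      intro z hz
      let T : Finset (Bool × ℝ) := Finset.univ.image
        (fun p : Bool × Fin n => (p.1, P (z p.1) ((p.2 : ℕ) + 1)))
      obtain ⟨i, hi⟩ := hcon T (Finset.card_image_le.trans (by simp))
      have hk : ∀ b, ∃ k : Fin (n + 1), 0 < d b i k z := by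
        intro b
        have h1 : ∃ k, k ≤ n ∧ P (z b) k < l b i ∧ ¬ P (z b) (k + 1) < l b i := by
          by_contra hc
          push Not at hc
          have : ∀ k, k ≤ n + 1 → P (z b) k < l b i := by
            intro k
            induction k with
            | zero =>
              intro _
              rw [hP0]
              exact (hM b i).1
            | succ k ih =>
              intro hk
              exact hc k (by omega) (ih (by omega))
          have h2 := this (n + 1) le_rfl
          rw [hP1 _ (hz b)] at h2
          linarith [(hM b i).2, hlr b i]
        obtain ⟨k, hk, h2, h3⟩ := h1
        push Not at h3
        refine ⟨⟨k, by omega⟩, (hdpos _ _ _ _).2 ⟨h2, ?_⟩⟩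
        by_cases hkn : k = n
        · subst hkn
          simp only
          rw [hP1 _ (hz b)]
          exact (hM b i).2
        · exact hi (b, P (z b) (k + 1)) (Finset.mem_image.2
            ⟨(b, ⟨k, by omega⟩), Finset.mem_univ _, rfl⟩) h3
      obtain ⟨k, hk1⟩ := hk false
      obtain ⟨k', hk2⟩ := hk true
      exact ⟨k, k', Finset.sum_pos' (fun i _ => mul_nonneg (hd0 _ _ _ _) (hd0 _ _ _ _))
        ⟨i, Finset.mem_univ _, mul_pos hk1 hk2⟩⟩)
    (by
      intro z hz k k' h
      obtain ⟨i, h1, h2⟩ := hwpos z k k' h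
      have key : ∀ b k, 0 < d b i k z → 0 < z b k := by
        intro b k hk
        obtain ⟨g1, g2⟩ := (hdpos _ _ _ _).1 hk
        rw [hPs] at g2
        have g3 := hlr b i
        have : 0 < 2 * M * z b k := by linarith
        exact pos_of_mul_pos_right this (by positivity)
      exact ⟨key _ _ h1, key _ _ h2⟩)
  have hch := fun k => hwpos z k (σ k) (hσ k)
  choose ix hix0 hix1 using hch
  have hsep : ∀ b k k' i j, k ≠ k' → 0 < d b i k z → 0 < d b j k' z →
      (r b i < l b j ∨ r b j < l b i) := by
    intro b k k' i j hne h1 h2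
    obtain ⟨a1, a2⟩ := (hdpos _ _ _ _).1 h1
    obtain ⟨b1, b2⟩ := (hdpos _ _ _ _).1 h2
    rcases lt_or_gt_of_ne hne with h | h
    · left
      have : P (z b) (k + 1) ≤ P (z b) k' := hPm _ (hz b) h
      linarith
    · right
      have : P (z b) (k' + 1) ≤ P (z b) k := hPm _ (hz b) h
      linarith
  have hsep' : ∀ k k', k ≠ k' → ∀ b, (r b (ix k) < l b (ix k') ∨ r b (ix k') < l b (ix k)) := by
    intro k k' hne b
    cases b
    · exact hsep false k k' _ _ hne (hix0 k) (hix0 k')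
    · exact hsep true (σ k) (σ k') _ _ (fun h => hne (σ.injective h)) (hix1 k) (hix1 k')
  have hinj : Function.Injective ix := by
    intro k k' h
    by_contra hne
    have h1 := hsep' k k' hne false
    rw [h] at h1
    have := hlr false (ix k')
    rcases h1 with h1 | h1 <;> linarith
  have hcard := hν (Finset.univ.image ix) (by
    intro i hi j hj hij b
    obtain ⟨k, -, rfl⟩ := Finset.mem_image.1 hi
    obtain ⟨k', -, rfl⟩ := Finset.mem_image.1 hj
    exact hsep' k k' (fun h => hij (by rw [h])) b)
  rw [Finset.card_image_of_injective _ hinj, Finset.card_univ, Fintype.card_fin] at hcard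
  omega

end Core
end TwoInt

/-- **Tardos's theorem**: for every finite system of 2-intervals,
`τ(𝔍) ≤ 2ν(𝔍)`.  Here `ν` is any upper bound on the packing number (the
maximal number of pairwise disjoint members), and we produce a transversal
of size at most `2ν`. -/
theorem two_interval_transversal (N : ℕ) (I : Fin N → Set (Bool × ℝ))
    (hI : ∀ i, IsTwoInterval (I i)) (ν : ℕ)
    (hν : ∀ S : Finset (Fin N),
      (∀ i ∈ S, ∀ j ∈ S, i ≠ j → Disjoint (I i) (I j)) → S.card ≤ ν) :
    ∃ T : Finset (Bool × ℝ), T.card ≤ 2 * ν ∧ ∀ i, ∃ p ∈ T, p ∈ I i := by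
  classical
  have hcomp : ∀ b i, ∃ a c : ℝ, a ≤ c ∧
      ({x : ℝ | (b, x) ∈ I i} = ∅ ∨ {x : ℝ | (b, x) ∈ I i} = Set.Icc a c) := by
    intro b i
    rcases (hI i).2 b with h | ⟨a, c, hac, h⟩
    · exact ⟨0, 0, le_rfl, Or.inl h⟩
    · exact ⟨a, c, hac, Or.inr h⟩
  choose a c hac hset using hcomp
  choose pt hpt using fun i => (hI i).1
  obtain ⟨Q, hQ⟩ : ∃ Q : ℝ, ∀ b i, c b i < Q := by
    refine ⟨1 + ∑ b, ∑ i, |c b i|, fun b i => ?_⟩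
    have h1 : ∑ i, |c b i| ≤ ∑ b, ∑ i, |c b i| :=
      Finset.single_le_sum (f := fun b => ∑ i, |c b i|)
        (fun b _ => Finset.sum_nonneg fun i _ => abs_nonneg _) (Finset.mem_univ b)
    have h2 : |c b i| ≤ ∑ i, |c b i| :=
      Finset.single_le_sum (f := fun i => |c b i|) (fun i _ => abs_nonneg _) (Finset.mem_univ i)
    have h4 := le_abs_self (c b i)
    linarith
  let E : Bool → Fin N → Prop := fun b i => {x : ℝ | (b, x) ∈ I i} = ∅
  let l : Bool → Fin N → ℝ := fun b i => if E b i then Q + ((i : ℕ) : ℝ) else a b i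
  let r : Bool → Fin N → ℝ := fun b i => if E b i then Q + ((i : ℕ) : ℝ) else c b i
  have hmem : ∀ b i, ¬ E b i → ∀ x, (b, x) ∈ I i ↔ l b i ≤ x ∧ x ≤ r b i := by
    intro b i hE x
    have h := (hset b i).resolve_left hE
    simp only [l, r, if_neg hE]
    rw [← Set.mem_Icc, ← h]
    rfl
  obtain ⟨T, hTc, hT⟩ := TwoInt.core N ν l r
    (by
      intro b i
      simp only [l, r]
      split_ifs
      · exact le_rfl
      · exact hac b i)
    (by
      intro S hS
      apply hν S
      intro i hi j hj hij
      rw [Set.disjoint_left]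
      rintro ⟨b, x⟩ hxi hxj
      have hEi : ¬ E b i := fun h => by
        have : x ∈ {x : ℝ | (b, x) ∈ I i} := hxi
        rw [h] at this
        exact this
      have hEj : ¬ E b j := fun h => by
        have : x ∈ {x : ℝ | (b, x) ∈ I j} := hxj
        rw [h] at this
        exact this
      have h1 := (hmem b i hEi x).1 hxi
      have h2 := (hmem b j hEj x).1 hxj
      rcases hS i hi j hj hij b with h | h <;> linarith [h1.1, h1.2, h2.1, h2.2])
  let φ : Bool × ℝ → Bool × ℝ := fun p =>
    if h : ∃ i : Fin N, p.2 = Q + ((i : ℕ) : ℝ) then pt h.choose else p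
  refine ⟨T.image φ, Finset.card_image_le.trans hTc, fun i => ?_⟩
  obtain ⟨p, hpT, hp1, hp2⟩ := hT i
  refine ⟨φ p, Finset.mem_image_of_mem _ hpT, ?_⟩
  by_cases hE : E p.1 i
  · simp only [l, r, if_pos hE] at hp1 hp2
    have hp : p.2 = Q + ((i : ℕ) : ℝ) := le_antisymm hp2 hp1
    have hex : ∃ i : Fin N, p.2 = Q + ((i : ℕ) : ℝ) := ⟨i, hp⟩
    have hi : hex.choose = i := by
      have := hex.choose_spec
      have h2 : ((i : ℕ) : ℝ) = ((hex.choose : ℕ) : ℝ) := by linarith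
      exact (Fin.ext (by exact_mod_cast h2)).symm
    simp only [φ, dif_pos hex, hi]
    exact hpt i
  · have hmemp : p ∈ I i := (hmem p.1 i hE p.2).2 ⟨hp1, hp2⟩
    simp only [r, if_neg hE] at hp2
    have hex : ¬ ∃ i : Fin N, p.2 = Q + ((i : ℕ) : ℝ) := by
      rintro ⟨j, hj⟩
      have h1 := hQ p.1 i
      have h2 : (0 : ℝ) ≤ ((j : ℕ) : ℝ) := Nat.cast_nonneg _
      linarith
    simp only [φ, dif_neg hex]
    exact hmemp
end

section
/- If a finite collection 𝕽 of closed axis-parallel rectangles in the plane has independence number at most m, then there exist at most 4m vertical and horizontal lines such that every rectangle in 𝕽 has its interior intersected by at least one of the lines. -/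
/-- A closed axis-parallel rectangle with nonempty interior:
`[x1, x2] × [y1, y2]` with `x1 < x2` and `y1 < y2`. -/
structure Rect where
  x1 : ℝ
  x2 : ℝ
  y1 : ℝ
  y2 : ℝ
  hx : x1 < x2
  hy : y1 < y2

/-- Two rectangles are independent if both their x-projections and their
y-projections are disjoint. -/
def Rect.Indep (R S : Rect) : Prop :=
  (R.x2 < S.x1 ∨ S.x2 < R.x1) ∧ (R.y2 < S.y1 ∨ S.y2 < R.y1)

/-- A vertical line `x = t` (encoded `(false, t)`) or a horizontal line
`y = t` (encoded `(true, t)`) slices the interior of a rectangle. -/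
def Slices (l : Bool × ℝ) (R : Rect) : Prop :=
  match l with
  | (false, t) => R.x1 < t ∧ t < R.x2
  | (true, t) => R.y1 < t ∧ t < R.y2


/-- `S` dominates all of `X` in the sense of Scarf. -/
def ScarfDom {X I L : Type*} [LinearOrder L] (v : I → X → L) (S : Finset X) : Prop :=
  ∀ x, ∃ i, ∀ s ∈ S, v i x ≤ v i s

theorem scarf_door {X I L : Type*} [Fintype X] [DecidableEq X] [Fintype I] [DecidableEq I]
    [LinearOrder L] (v : I → X → L) (hinj : ∀ i, Function.Injective (v i)) (e : I → X)
    (h1 : ∀ i x, x ≠ e i → v i (e i) < v i x)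
    (h2 : ∀ i j x, j ≠ i → (∀ k, x ≠ e k) → v i x < v i (e j))
    (S : Finset X) (hS : S.card + 1 = Fintype.card I) (t : X) (htS : t ∈ S)
    (ht : ∀ k, t ≠ e k) (hd : ScarfDom v S) :
    ∃ p q : X, p ≠ q ∧ ∀ x, (x ∉ S ∧ ScarfDom v (insert x S)) ↔ (x = p ∨ x = q) := by
  classical
  have hne : S.Nonempty := ⟨t, htS⟩
  have hmin : ∀ i, ∃ s ∈ S, ∀ y ∈ S, v i s ≤ v i y := fun i => S.exists_min_image (v i) hne
  choose μ hμS hμ using hmin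
  have hsurj : ∀ s ∈ S, ∃ i, μ i = s := by
    intro s hs
    obtain ⟨i, hi⟩ := hd s
    exact ⟨i, hinj i (le_antisymm (hμ i s hs) (hi _ (hμS i)))⟩
  obtain ⟨a, -, b, -, hab, hμab⟩ : ∃ a ∈ (Finset.univ : Finset I), ∃ b ∈ (Finset.univ : Finset I),
      a ≠ b ∧ μ a = μ b :=
    Finset.exists_ne_map_eq_of_card_lt_of_maps_to
      (by rw [Finset.card_univ]; omega) (fun i _ => hμS i)
  have hinjOn : ∀ i j, i ≠ a → j ≠ a → μ i = μ j → i = j := by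
    have himg : (Finset.univ.erase a).image μ = S := by
      ext s
      simp only [Finset.mem_image, Finset.mem_erase, Finset.mem_univ, and_true]
      constructor
      · rintro ⟨i, _, rfl⟩; exact hμS i
      · intro hs
        obtain ⟨i, rfl⟩ := hsurj s hs
        by_cases hia : i = a
        · exact ⟨b, hab.symm, by rw [hia, hμab]⟩
        · exact ⟨i, hia, rfl⟩
    have hcard : ((Finset.univ.erase a).image μ).card = (Finset.univ.erase a).card := by
      rw [himg, Finset.card_erase_of_mem (Finset.mem_univ _), Finset.card_univ]; omega
    have := Finset.card_image_iff.mp hcard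
    intro i j hi hj hij
    exact this (by simp [hi]) (by simp [hj]) hij
  have hinjOn2 : ∀ i j, μ i = μ j → i = j ∨ (i = a ∧ j = b) ∨ (i = b ∧ j = a) := by
    intro i j hij
    by_cases hi : i = a
    · by_cases hj : j = a
      · left; rw [hi, hj]
      · right; left
        exact ⟨hi, hinjOn j b hj hab.symm (by rw [← hij, hi, hμab])⟩
    · by_cases hj : j = a
      · right; right
        exact ⟨hinjOn i b hi hab.symm (by rw [hij, hj, hμab]), hj⟩
      · left; exact hinjOn i j hi hj hij
  have key : ∀ a b : I, a ≠ b → μ a = μ b → ∃ x, v a x < v a (μ a) ∧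
      (∀ j, j ≠ a → v j (μ j) < v j x) ∧
      (∀ y, (∀ j, j ≠ a → v j (μ j) < v j y) → v a y ≤ v a x) := by
    intro a b hab hμab
    let M : Finset X := Finset.univ.filter (fun y => ∀ j, j ≠ a → v j (μ j) < v j y)
    have hM : M.Nonempty := by
      refine ⟨e a, ?_⟩
      simp only [M, Finset.mem_filter, Finset.mem_univ, true_and]
      intro j hj
      exact lt_of_le_of_lt (hμ j t htS) (h2 j a t (Ne.symm hj) ht)
    obtain ⟨x, hxM, hx⟩ := M.exists_max_image (v a) hM
    simp only [M, Finset.mem_filter, Finset.mem_univ, true_and] at hxM hx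
    refine ⟨x, ?_, hxM, hx⟩
    obtain ⟨i, hi⟩ := hd x
    have hia : i = a := by
      by_contra hia
      exact absurd (hi _ (hμS i)) (not_le.mpr (hxM i hia))
    subst hia
    refine lt_of_le_of_ne (hi _ (hμS i)) ?_
    intro heq
    have hxe := hinj _ heq
    have := hxM b hab.symm
    rw [hxe, ← hμab] at this
    exact lt_irrefl _ this
  have room : ∀ a b : I, a ≠ b → μ a = μ b → ∀ x, v a x < v a (μ a) →
      (∀ j, j ≠ a → v j (μ j) < v j x) →
      (∀ y, (∀ j, j ≠ a → v j (μ j) < v j y) → v a y ≤ v a x) →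
      (x ∉ S ∧ ScarfDom v (insert x S)) := by
    intro a b hab hμab x hxa hxj hmax
    refine ⟨fun hxS => absurd (hμ a x hxS) (not_le.mpr hxa), ?_⟩
    intro y
    by_cases hy : ∀ j, j ≠ a → v j (μ j) < v j y
    · refine ⟨a, fun s hs => ?_⟩
      rcases Finset.mem_insert.mp hs with rfl | hs
      · exact hmax y hy
      · exact (hmax y hy).trans (hxa.le.trans (hμ a s hs))
    · push Not at hy
      obtain ⟨j, hja, hj⟩ := hy
      refine ⟨j, fun s hs => ?_⟩
      rcases Finset.mem_insert.mp hs with rfl | hs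
      · exact hj.trans (hxj j hja).le
      · exact hj.trans (hμ j s hs)
  obtain ⟨p, hp1, hp2, hp3⟩ := key a b hab hμab
  obtain ⟨q, hq1, hq2, hq3⟩ := key b a hab.symm hμab.symm
  refine ⟨p, q, ?_, ?_⟩
  · rintro rfl
    exact lt_asymm hp1 (hq2 a hab)
  intro x
  constructor
  · rintro ⟨hxS, hdom⟩
    obtain ⟨k, hk⟩ := hdom x
    have hkx : v k x < v k (μ k) := lt_of_le_of_ne (hk _ (Finset.mem_insert_of_mem (hμS k)))
      (fun h => hxS (hinj _ h ▸ hμS k))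
    have hother : ∀ s ∈ S, ∃ i, μ i = s ∧ v i s ≤ v i x := by
      intro s hs
      obtain ⟨i, hi⟩ := hdom s
      exact ⟨i, hinj i (le_antisymm (hμ i s hs) (hi _ (Finset.mem_insert_of_mem (hμS i)))),
        hi _ (Finset.mem_insert_self _ _)⟩
    have hkab : k = a ∨ k = b := by
      obtain ⟨i, hi, hi2⟩ := hother (μ k) (hμS k)
      rcases hinjOn2 i k hi with h | h | h
      · subst h; exact absurd hkx (not_lt.mpr hi2)
      · exact Or.inr h.2
      · exact Or.inl h.2
    have fin : ∀ a b : I, a ≠ b → μ a = μ b → 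
        (∀ i j, μ i = μ j → i = j ∨ (i = a ∧ j = b) ∨ (i = b ∧ j = a)) →
        v a x < v a (μ a) → ∀ p, v a p < v a (μ a) →
      (∀ j, j ≠ a → v j (μ j) < v j p) →
      (∀ y, (∀ j, j ≠ a → v j (μ j) < v j y) → v a y ≤ v a p) → x = p := by
      intro a b hab hμab hinj2 hxa p hp1 hp2 hp3
      have hxj : ∀ j, j ≠ a → v j (μ j) < v j x := by
        intro j hj
        obtain ⟨i, hi, hi2⟩ := hother (μ j) (hμS j)
        have : i = j := by
          rcases hinj2 i j hi with h | h | h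
          · exact h
          · rw [h.1, h.2, ← hμab] at hi2
            exact absurd hxa (not_lt.mpr hi2)
          · exact absurd h.2 hj
        subst this
        exact lt_of_le_of_ne hi2 (fun h => hxS (hinj _ h ▸ hμS i))
      apply hinj a
      refine le_antisymm (hp3 x hxj) ?_
      obtain ⟨i, hi⟩ := hdom p
      have : i = a := by
        by_contra hia
        exact absurd (hi _ (Finset.mem_insert_of_mem (hμS i))) (not_le.mpr (hp2 i hia))
      subst this
      exact hi _ (Finset.mem_insert_self _ _)
    rcases hkab with rfl | rfl
    · left; exact fin k b hab hμab hinjOn2 hkx p hp1 hp2 hp3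
    · right
      exact fin k a hab.symm hμab.symm (fun i j h => by
        rcases hinjOn2 i j h with h | h | h <;> tauto) hkx q hq1 hq2 hq3
  · rintro (rfl | rfl)
    · exact room a b hab hμab _ hp1 hp2 hp3
    · exact room b a hab.symm hμab.symm _ hq1 hq2 hq3

theorem scarf_lemma {X I L : Type*} [Fintype X] [DecidableEq X] [Fintype I] [DecidableEq I]
    [LinearOrder L] (v : I → X → L) (hinj : ∀ i, Function.Injective (v i)) (e : I → X)
    (h1 : ∀ i x, x ≠ e i → v i (e i) < v i x)
    (h2 : ∀ i j x, j ≠ i → (∀ k, x ≠ e k) → v i x < v i (e j))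
    (t0 : X) (ht0 : ∀ k, t0 ≠ e k) (c : X → I) (hc : ∀ j, c (e j) = j) (i0 : I) :
    ∃ S : Finset X, S.card = Fintype.card I ∧ ScarfDom v S ∧ S.image c = Finset.univ := by
  classical
  by_contra hno
  push Not at hno
  have hei : Function.Injective e := fun i j h => by rw [← hc i, h, hc]
  have mono : ∀ S S' : Finset X, S ⊆ S' → ScarfDom v S' → ScarfDom v S :=
    fun S S' hss h x => (h x).imp fun i hi s hs => hi s (hss hs)
  let P : Finset (Finset X × X) := Finset.univ.filter fun p =>
    p.1.card + 1 = Fintype.card I ∧ p.1.image c = Finset.univ.erase i0 ∧ p.2 ∉ p.1 ∧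
      ScarfDom v (insert p.2 p.1)
  let S0 : Finset X := (Finset.univ.erase i0).image e
  have hIpos : 0 < Fintype.card I := Fintype.card_pos_iff.mpr ⟨i0⟩
  have heven : Even P.card := by
    rw [Finset.card_eq_sum_card_fiberwise (f := fun p => insert p.2 p.1) (t := Finset.univ)
      (fun _ _ => by simp)]
    refine Finset.even_sum _ fun R _ => ?_
    by_cases hR : ((P.filter fun p => insert p.2 p.1 = R)).Nonempty
    swap
    · rw [Finset.not_nonempty_iff_eq_empty.mp hR]; simp
    obtain ⟨⟨S, x⟩, hp⟩ := hR
    simp only [P, Finset.mem_filter, Finset.mem_univ, true_and] at hp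
    obtain ⟨⟨hcard, himg, hx, hdom⟩, rfl⟩ := hp
    have hcx : c x ≠ i0 := by
      intro h
      refine hno (insert x S) (by rw [Finset.card_insert_of_notMem hx, hcard]) hdom ?_
      rw [Finset.image_insert, himg, h, Finset.insert_erase (Finset.mem_univ _)]
    have hinjS : Set.InjOn c S := by
      apply Finset.card_image_iff.mp
      rw [himg, Finset.card_erase_of_mem (Finset.mem_univ _), Finset.card_univ]; omega
    obtain ⟨y, hyS, hyx⟩ : ∃ y ∈ S, c y = c x := by
      have : c x ∈ S.image c := by rw [himg]; simp [hcx]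
      simpa using this
    have hyx' : y ≠ x := fun h => hx (h ▸ hyS)
    have : (P.filter fun p => insert p.2 p.1 = insert x S) =
        {(S, x), ((insert x S).erase y, y)} := by
      ext ⟨S', x'⟩
      simp only [P, Finset.mem_filter, Finset.mem_univ, true_and, Finset.mem_insert,
        Finset.mem_singleton, Prod.mk.injEq]
      constructor
      · rintro ⟨⟨hcard', himg', hx', hdom'⟩, heq⟩
        have hS' : S' = (insert x S).erase x' := by rw [← heq, Finset.erase_insert hx']
        have hx'mem : x' ∈ insert x S := by rw [← heq]; simp
        by_cases h1 : x' = x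
        · left; subst h1; exact ⟨by rw [hS', Finset.erase_insert hx], rfl⟩
        by_cases h2 : x' = y
        · right; subst h2; exact ⟨hS', rfl⟩
        exfalso
        have hinjS' : Set.InjOn c S' := by
          apply Finset.card_image_iff.mp
          rw [himg', Finset.card_erase_of_mem (Finset.mem_univ _), Finset.card_univ]; omega
        apply hyx'
        apply hinjS' _ _ hyx
        · rw [hS']; simp [hyS, Ne.symm h2]
        · rw [hS']; simp [Ne.symm h1]
      · rintro (⟨rfl, rfl⟩ | ⟨rfl, rfl⟩)
        · exact ⟨⟨hcard, himg, hx, hdom⟩, rfl⟩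
        · have hym : x' ∈ insert x S := Finset.mem_insert_of_mem hyS
          refine ⟨⟨?_, ?_, by simp, ?_⟩, Finset.insert_erase hym⟩
          · rw [Finset.card_erase_of_mem hym, Finset.card_insert_of_notMem hx]; simpa using hcard
          · rw [← himg]
            ext k
            simp only [Finset.mem_image, Finset.mem_erase, Finset.mem_insert]
            constructor
            · rintro ⟨z, ⟨hz, rfl | hz'⟩, rfl⟩
              · exact ⟨x', hyS, hyx⟩
              · exact ⟨z, hz', rfl⟩
            · rintro ⟨z, hz, rfl⟩
              by_cases hzx : z = x'
              · exact ⟨x, ⟨hyx'.symm, Or.inl rfl⟩, by rw [hzx, hyx]⟩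
              · exact ⟨z, ⟨hzx, Or.inr hz⟩, rfl⟩
          · rw [Finset.insert_erase hym]; exact hdom
    rw [this, Finset.card_pair]
    · exact even_two
    · simp only [ne_eq, Prod.mk.injEq, not_and]
      intro _ h; exact hyx' h.symm
  have hodd : Odd P.card := by
    rw [Finset.card_eq_sum_card_fiberwise (f := fun p => p.1) (t := Finset.univ)
      (fun _ _ => by simp), ← Finset.add_sum_erase _ _ (Finset.mem_univ S0)]
    refine Odd.add_even ?_ (Finset.even_sum _ fun S hS => ?_)
    ·
      obtain ⟨x, hx, hxmax⟩ := (Finset.univ.filter fun x : X => ∀ k, x ≠ e k).exists_max_image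
        (v i0) ⟨t0, by simpa using ht0⟩
      simp only [Finset.mem_filter, Finset.mem_univ, true_and] at hx hxmax
      have : (P.filter fun p => p.1 = S0) = {(S0, x)} := by
        ext ⟨S', x'⟩
        simp only [P, Finset.mem_filter, Finset.mem_univ, true_and,
          Finset.mem_singleton, Prod.mk.injEq]
        constructor
        · rintro ⟨⟨hcard', himg', hx', hdom'⟩, rfl⟩
          refine ⟨rfl, ?_⟩
          have hx'T : ∀ k, x' ≠ e k := by
            rintro k rfl
            by_cases hk : k = i0
            · subst hk
              obtain ⟨i, hi⟩ := hdom' t0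
              have : e i ∈ insert (e k) S0 := by
                by_cases hik : i = k
                · simp [hik]
                · exact Finset.mem_insert_of_mem (Finset.mem_image_of_mem _ (by simp [hik]))
              exact absurd (hi _ this) (not_le.mpr (h1 i t0 (ht0 i)))
            · exact hx' (Finset.mem_image_of_mem _ (by simp [hk]))
          apply hinj i0
          refine le_antisymm (hxmax x' hx'T) ?_
          obtain ⟨i, hi⟩ := hdom' x
          have : i = i0 := by
            by_contra hii
            have : e i ∈ insert x' S0 :=
              Finset.mem_insert_of_mem (Finset.mem_image_of_mem _ (by simp [hii]))
            exact absurd (hi _ this) (not_le.mpr (h1 i x (hx i)))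
          subst this
          exact hi _ (Finset.mem_insert_self _ _)
        · rintro ⟨rfl, rfl⟩
          refine ⟨⟨?_, ?_, ?_, ?_⟩, rfl⟩
          · rw [Finset.card_image_of_injective _ hei, Finset.card_erase_of_mem (Finset.mem_univ _),
              Finset.card_univ]; omega
          · rw [Finset.image_image]
            have : c ∘ e = id := funext hc
            rw [this, Finset.image_id]
          · intro h
            obtain ⟨k, _, hk⟩ := Finset.mem_image.mp h
            exact hx k hk.symm
          · intro y
            by_cases hy : ∃ k, y = e k
            · obtain ⟨k, rfl⟩ := hy
              refine ⟨k, fun s _ => ?_⟩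
              by_cases hs : s = e k
              · rw [hs]
              · exact (h1 k s hs).le
            · push Not at hy
              refine ⟨i0, fun s hs => ?_⟩
              rcases Finset.mem_insert.mp hs with rfl | hs
              · exact hxmax y hy
              · obtain ⟨k, hk, rfl⟩ := Finset.mem_image.mp hs
                exact (h2 i0 k y (by simpa using hk) hy).le
      rw [this]; simp
    · by_cases hne : (P.filter fun p => p.1 = S).Nonempty
      swap
      · rw [Finset.not_nonempty_iff_eq_empty.mp hne]; simp
      obtain ⟨⟨S', x⟩, hp⟩ := hne
      simp only [P, Finset.mem_filter, Finset.mem_univ, true_and] at hp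
      obtain ⟨⟨hcard, himg, hx, hdom⟩, rfl⟩ := hp
      have hSS0 : S' ≠ S0 := (Finset.mem_erase.mp hS).1
      obtain ⟨t, htS, ht⟩ : ∃ t ∈ S', ∀ k, t ≠ e k := by
        by_contra hcon
        push Not at hcon
        apply hSS0
        apply Finset.eq_of_subset_of_card_le
        · intro s hs
          obtain ⟨k, rfl⟩ := hcon s hs
          apply Finset.mem_image_of_mem
          rw [← himg]
          have := Finset.mem_image_of_mem c hs
          rwa [hc] at this
        · rw [Finset.card_image_of_injective _ hei, Finset.card_erase_of_mem (Finset.mem_univ _),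
              Finset.card_univ]; omega
      obtain ⟨p, q, hpq, hiff⟩ := scarf_door v hinj e h1 h2 S' hcard t htS ht
        (mono _ _ (Finset.subset_insert _ _) hdom)
      have : (P.filter fun r => r.1 = S') = {(S', p), (S', q)} := by
        ext ⟨S'', x'⟩
        simp only [P, Finset.mem_filter, Finset.mem_univ, true_and, Finset.mem_insert,
          Finset.mem_singleton, Prod.mk.injEq]
        constructor
        · rintro ⟨⟨_, _, hx', hdom'⟩, rfl⟩
          rcases (hiff x').mp ⟨hx', hdom'⟩ with h | h
          · exact Or.inl ⟨rfl, h⟩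
          · exact Or.inr ⟨rfl, h⟩
        · rintro (⟨rfl, rfl⟩ | ⟨rfl, rfl⟩)
          · have := (hiff x').mpr (Or.inl rfl)
            exact ⟨⟨hcard, himg, this.1, this.2⟩, rfl⟩
          · have := (hiff x').mpr (Or.inr rfl)
            exact ⟨⟨hcard, himg, this.1, this.2⟩, rfl⟩
      rw [this, Finset.card_pair]
      · exact even_two
      · simp only [ne_eq, Prod.mk.injEq, true_and]; exact hpq
  exact (Nat.not_even_iff_odd.mpr hodd) heven

theorem scarf_grid {I : Type*} [Fintype I] [DecidableEq I] (N : ℕ) (c : (I → ℕ) → I) (i0 : I) :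
    ∃ s : I → ℕ, ∑ i, s i = N ∧ ∀ i, s i ≤ Fintype.card I ∨
      ∃ s' : I → ℕ, ∑ i, s' i = N ∧ c s' = i ∧
        ∀ j, s j ≤ s' j + Fintype.card I ∧ s' j ≤ s j + Fintype.card I := by
  classical
  let T := ↥(Finset.piAntidiag (Finset.univ : Finset I) N)
  let X := T ⊕ I
  have hT : ∀ t : T, ∑ i, t.1 i = N := fun t => (Finset.mem_piAntidiag.mp t.2).1
  have mkT : ∀ s : I → ℕ, ∑ i, s i = N → ∃ t : T, t.1 = s := fun s hs =>
    ⟨⟨s, Finset.mem_piAntidiag.mpr ⟨hs, fun _ _ => Finset.mem_univ _⟩⟩, rfl⟩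
  have hle : ∀ (t : T) i, t.1 i ≤ N := fun t i => by
    refine le_trans ?_ (hT t).le; exact Finset.single_le_sum (fun _ _ => Nat.zero_le _) (Finset.mem_univ i)
  let w : I → X → ℤ := fun i x => Sum.elim (fun t : T => (t.1 i : ℤ))
    (fun j => if i = j then -1 else (N : ℤ) + 1) x
  let v : I → X → ℤ ×ₗ Fin (Fintype.card X) := fun i x => toLex (w i x, Fintype.equivFin X x)
  have hinj : ∀ i, Function.Injective (v i) := by
    intro i x y h
    have h' := congrArg (fun z => (ofLex z).2) h
    exact (Fintype.equivFin X).injective h'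
  have hvw : ∀ i x y, w i x < w i y → v i x < v i y := fun i x y h =>
    Prod.Lex.toLex_lt_toLex.mpr (Or.inl h)
  have hwv : ∀ i x y, v i x ≤ v i y → w i x ≤ w i y := fun i x y h => by
    by_contra hlt
    exact absurd h (not_le.mpr (hvw i y x (not_le.mp hlt)))
  let e : I → X := Sum.inr
  obtain ⟨t0, ht0⟩ := mkT (Pi.single i0 N) (by simp)
  obtain ⟨S, hcard, hdom, himg⟩ := scarf_lemma v hinj e
    (by
      rintro i (t | j) hx
      · apply hvw; simp [w, e]; omega
      · apply hvw
        have : i ≠ j := fun h => hx (by rw [h])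
        simp [w, e, this])
    (by
      rintro i j (t | k) hji hx
      · apply hvw
        have := hle t i
        simp [w, e, Ne.symm hji]; omega
      · exact absurd rfl (hx k))
    (Sum.inl t0) (by simp [e]) (Sum.elim (fun t : T => c t.1) id) (by simp [e]) i0
  let C : Finset I := Finset.univ.filter fun i => e i ∉ S
  have hdom' : ∀ x : T, ∃ i ∈ C, ∀ s : T, Sum.inl s ∈ S → x.1 i ≤ s.1 i := by
    intro x
    obtain ⟨i, hi⟩ := hdom (Sum.inl x)
    refine ⟨i, ?_, ?_⟩
    · simp only [C, Finset.mem_filter, Finset.mem_univ, true_and]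
      intro h
      have := hwv _ _ _ (hi _ h)
      simp [w, e] at this
      omega
    · intro s hs
      have := hwv _ _ _ (hi _ hs)
      simpa [w] using this
  have hcol : ∀ i ∈ C, ∃ s : T, Sum.inl s ∈ S ∧ c s.1 = i := by
    intro i hi
    have : i ∈ S.image (Sum.elim (fun t : T => c t.1) id) := by rw [himg]; simp
    obtain ⟨x, hx, hxi⟩ := Finset.mem_image.mp this
    rcases x with t | j
    · exact ⟨t, hx, hxi⟩
    · simp only [Sum.elim_inr, id] at hxi
      subst hxi
      simp only [C, Finset.mem_filter, Finset.mem_univ, true_and] at hi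
      exact absurd hx hi
  obtain ⟨k0, hk0, -⟩ := hdom' t0
  obtain ⟨s0, hs0, -⟩ := hcol k0 hk0
  let σ : Finset T := Finset.univ.filter fun t => Sum.inl t ∈ S
  have hσ : σ.Nonempty := ⟨s0, by simpa [σ] using hs0⟩
  have hmin : ∀ i, ∃ m, (∀ s : T, Sum.inl s ∈ S → m ≤ s.1 i) ∧ ∃ s : T, Sum.inl s ∈ S ∧ s.1 i = m := by
    intro i
    obtain ⟨s, hs, h⟩ := σ.exists_min_image (fun t => t.1 i) hσ
    simp only [σ, Finset.mem_filter, Finset.mem_univ, true_and] at hs h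
    exact ⟨s.1 i, h, s, hs, rfl⟩
  choose m hm hm' using hmin
  have hbig : N < ∑ i ∈ C, (m i + 1) := by
    by_contra hcon
    push Not at hcon
    let x : I → ℕ := fun i => (if i ∈ C then m i + 1 else 0) +
      (if i = k0 then N - ∑ i ∈ C, (m i + 1) else 0)
    have hx : ∑ i, x i = N := by
      simp only [x, Finset.sum_add_distrib, Finset.sum_ite_eq', Finset.mem_univ, if_true,
        Finset.sum_ite_mem, Finset.univ_inter]
      rw [Finset.sum_add_distrib] at hcon
      omega
    obtain ⟨t, ht⟩ := mkT x hx
    obtain ⟨i, hiC, hi⟩ := hdom' t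
    obtain ⟨s, hs, hsm⟩ := hm' i
    have := hi s hs
    rw [ht, hsm] at this
    simp only [x, hiC, if_true] at this
    omega
  have hCn : C.card ≤ Fintype.card I := Finset.card_le_univ C
  rw [Finset.sum_add_distrib, Finset.sum_const, smul_eq_mul, mul_one] at hbig
  have hin : ∀ s : T, Sum.inl s ∈ S → ∀ i ∈ C, s.1 i ≤ m i + Fintype.card I := by
    intro s hs i hi
    have h1 : ∑ i ∈ C, s.1 i ≤ N := by
      refine le_trans ?_ (hT s).le; exact Finset.sum_le_sum_of_subset (Finset.subset_univ _)
    rw [← Finset.add_sum_erase _ _ hi] at h1 hbig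
    have h2 : ∑ i ∈ C.erase i, m i ≤ ∑ i ∈ C.erase i, s.1 i :=
      Finset.sum_le_sum fun j _ => hm j s hs
    omega
  have hout : ∀ s : T, Sum.inl s ∈ S → ∀ i, i ∉ C → s.1 i ≤ Fintype.card I := by
    intro s hs i hi
    have h1 : ∑ i ∈ insert i C, s.1 i ≤ N := by
      refine le_trans ?_ (hT s).le; exact Finset.sum_le_sum_of_subset (Finset.subset_univ _)
    rw [Finset.sum_insert hi] at h1
    have h2 : ∑ i ∈ C, m i ≤ ∑ i ∈ C, s.1 i :=
      Finset.sum_le_sum fun j _ => hm j s hs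
    omega
  have hclose : ∀ s s' : T, Sum.inl s ∈ S → Sum.inl s' ∈ S → ∀ i,
      s.1 i ≤ s'.1 i + Fintype.card I := by
    intro s s' hs hs' i
    by_cases hi : i ∈ C
    · have := hin s hs i hi
      have := hm i s' hs'
      omega
    · have := hout s hs i hi
      omega
  refine ⟨s0.1, hT s0, fun i => ?_⟩
  by_cases hi : i ∈ C
  · right
    obtain ⟨s', hs', hc'⟩ := hcol i hi
    exact ⟨s'.1, hT s', hc', fun j => ⟨hclose s0 s' hs0 hs' j, hclose s' s0 hs' hs0 j⟩⟩
  · left; exact hout s0 hs0 i hi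

/-- Brouwer fixed point theorem for the standard simplex. -/
theorem brouwer_simplex {I : Type*} [Fintype I] [Nonempty I] (f : (I → ℝ) → (I → ℝ))
    (hf : Continuous f) (hmaps : ∀ x ∈ stdSimplex ℝ I, f x ∈ stdSimplex ℝ I) :
    ∃ x ∈ stdSimplex ℝ I, f x = x := by
  classical
  have hcomp : IsCompact (stdSimplex ℝ I) := isCompact_stdSimplex ℝ I
  obtain ⟨i0⟩ := ‹Nonempty I›
  have happrox : ∀ ε > 0, ∃ x ∈ stdSimplex ℝ I, ∀ i, x i ≤ f x i + ε := by
    intro ε hε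
    have huc := hcomp.uniformContinuousOn_of_continuous hf.continuousOn
    rw [Metric.uniformContinuousOn_iff] at huc
    obtain ⟨δ, hδ, hδf⟩ := huc (ε / 2) (by positivity)
    obtain ⟨N, hN⟩ := exists_nat_gt ((Fintype.card I : ℝ) / min (δ / 2) (ε / 2))
    have hmin : 0 < min (δ / 2) (ε / 2) := by positivity
    have hNpos : (0 : ℝ) < N := lt_of_le_of_lt (by positivity) hN
    have hq : (Fintype.card I : ℝ) / N < min (δ / 2) (ε / 2) := by
      rw [div_lt_iff₀ hmin] at hN
      rw [div_lt_iff₀ hNpos]; linarith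
    have hq1 : (Fintype.card I : ℝ) / N < δ / 2 := hq.trans_le (min_le_left _ _)
    have hq2 : (Fintype.card I : ℝ) / N < ε / 2 := hq.trans_le (min_le_right _ _)
    let g : (I → ℕ) → (I → ℝ) := fun s i => (s i : ℝ) / N
    have hg : ∀ s, ∑ i, s i = N → g s ∈ stdSimplex ℝ I := by
      intro s hs
      refine ⟨fun i => by positivity, ?_⟩
      simp only [g]
      rw [← Finset.sum_div, ← Nat.cast_sum, hs, div_self hNpos.ne']
    have hcol : ∀ s : I → ℕ, ∃ i, ∑ i, s i = N → g s i ≤ f (g s) i := by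
      intro s
      by_cases hs : ∑ i, s i = N
      · by_contra hcon
        push Not at hcon
        have : ∑ i, f (g s) i < ∑ i, g s i :=
          Finset.sum_lt_sum_of_nonempty ⟨i0, Finset.mem_univ _⟩ fun i _ => (hcon i).2
        rw [(hmaps _ (hg s hs)).2, (hg s hs).2] at this
        exact lt_irrefl _ this
      · exact ⟨i0, fun h => absurd h hs⟩
    choose c hc using hcol
    obtain ⟨s, hs, hs'⟩ := scarf_grid N c i0
    refine ⟨g s, hg s hs, fun i => ?_⟩
    rcases hs' i with h | ⟨s', hs'N, hci, hclose⟩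
    · have h0 := (hmaps _ (hg s hs)).1 i
      have : g s i ≤ (Fintype.card I : ℝ) / N := by
        simp only [g]; gcongr
      linarith
    · have hcl : ∀ j, |g s j - g s' j| ≤ (Fintype.card I : ℝ) / N := by
        intro j
        simp only [g]
        rw [← sub_div, abs_div, abs_of_pos hNpos]
        gcongr
        have h1 : (s j : ℝ) ≤ s' j + Fintype.card I := by exact_mod_cast (hclose j).1
        have h2 : (s' j : ℝ) ≤ s j + Fintype.card I := by exact_mod_cast (hclose j).2
        rw [abs_le]; constructor <;> linarith
      have hdist : dist (g s) (g s') < δ := by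
        refine lt_of_le_of_lt ((dist_pi_le_iff (by positivity)).mpr fun j => ?_)
          (hq1.trans (by linarith))
        rw [Real.dist_eq]; exact hcl j
      have hfd := hδf _ (hg s hs) _ (hg s' hs'N) hdist
      have h3 := (dist_le_pi_dist (f (g s)) (f (g s')) i).trans_lt hfd
      rw [Real.dist_eq, abs_lt] at h3
      have h4 := abs_le.mp (hcl i)
      have h5 := hc s' hs'N
      rw [hci] at h5
      linarith [h3.1, h4.2]
  let G : (I → ℝ) → ℝ := fun x => ∑ i, max 0 (x i - f x i)
  have hG : Continuous G := by
    have : ∀ i, Continuous fun x => f x i := fun i => (continuous_apply i).comp hf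
    fun_prop
  obtain ⟨x, hx, hxmin⟩ := hcomp.exists_isMinOn
    ⟨_, single_mem_stdSimplex ℝ i0⟩ hG.continuousOn
  have hG0 : G x ≤ 0 := by
    by_contra hpos
    push Not at hpos
    have hcard : (0 : ℝ) < Fintype.card I := by
      exact_mod_cast Fintype.card_pos_iff.mpr ⟨i0⟩
    obtain ⟨y, hy, hy'⟩ := happrox (G x / (2 * Fintype.card I)) (by positivity)
    have h1 : G x ≤ G y := hxmin hy
    have h2 : G y ≤ ∑ _i : I, G x / (2 * Fintype.card I) :=
      Finset.sum_le_sum fun i _ => max_le (by positivity) (by linarith [hy' i])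
    rw [Finset.sum_const, Finset.card_univ, nsmul_eq_mul] at h2
    have h3 : (Fintype.card I : ℝ) * (G x / (2 * Fintype.card I)) = G x / 2 := by
      field_simp
    linarith
  have hle : ∀ i, x i ≤ f x i := by
    intro i
    have h1 : max 0 (x i - f x i) ≤ G x :=
      Finset.single_le_sum (f := fun i => max 0 (x i - f x i)) (fun _ _ => le_max_left _ _)
        (Finset.mem_univ i)
    have := le_max_right 0 (x i - f x i)
    linarith
  refine ⟨x, hx, ?_⟩
  have hsum : ∑ i, x i = ∑ i, f x i := by rw [hx.2, (hmaps x hx).2]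
  funext i
  exact ((Finset.sum_eq_sum_iff_of_le fun i _ => hle i).mp hsum i (Finset.mem_univ i)).symm

/-- Normalisation of a point of the big simplex onto a factor. -/
noncomputable def tardosProj {J : Type*} [Fintype J] (u : J → ℝ) : J → ℝ := fun i =>
  (u i + max 0 (1 / 2 - ∑ k, u k) / Fintype.card J) / max (∑ k, u k) (1 / 2)

theorem tardosProj_continuous {J : Type*} [Fintype J] : Continuous (tardosProj (J := J)) := by
  refine continuous_pi fun i => ?_
  unfold tardosProj
  refine Continuous.div (by fun_prop) (by fun_prop) fun u => ?_
  have := le_max_right (∑ k, u k) (1 / 2 : ℝ)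
  linarith

theorem tardosProj_mem {J : Type*} [Fintype J] [Nonempty J] (u : J → ℝ) (hu : ∀ i, 0 ≤ u i) :
    tardosProj u ∈ stdSimplex ℝ J := by
  have hpos : 0 < max (∑ k, u k) (1 / 2 : ℝ) := lt_max_of_lt_right (by norm_num)
  have hcard : (0 : ℝ) < Fintype.card J := by exact_mod_cast Fintype.card_pos
  refine ⟨fun i => ?_, ?_⟩
  · have := hu i
    unfold tardosProj; positivity
  · unfold tardosProj
    rw [← Finset.sum_div, Finset.sum_add_distrib, Finset.sum_const, Finset.card_univ, nsmul_eq_mul,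
      mul_div_cancel₀ _ hcard.ne', div_eq_one_iff_eq hpos.ne']
    rcases le_total (∑ k, u k) (1 / 2 : ℝ) with h | h
    · rw [max_eq_right h, max_eq_right (by linarith)]; ring
    · rw [max_eq_left h, max_eq_left (by linarith)]; ring

theorem brouwer_prod {J : Type*} [Fintype J] [Nonempty J] (g1 g2 : (J → ℝ) → (J → ℝ) → (J → ℝ))
    (hg1 : Continuous fun p : (J → ℝ) × (J → ℝ) => g1 p.1 p.2)
    (hg2 : Continuous fun p : (J → ℝ) × (J → ℝ) => g2 p.1 p.2)
    (hm1 : ∀ x ∈ stdSimplex ℝ J, ∀ y ∈ stdSimplex ℝ J, g1 x y ∈ stdSimplex ℝ J)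
    (hm2 : ∀ x ∈ stdSimplex ℝ J, ∀ y ∈ stdSimplex ℝ J, g2 x y ∈ stdSimplex ℝ J) :
    ∃ x ∈ stdSimplex ℝ J, ∃ y ∈ stdSimplex ℝ J, g1 x y = x ∧ g2 x y = y := by
  let X : (J ⊕ J → ℝ) → J → ℝ := fun z => tardosProj fun i => z (Sum.inl i)
  let Y : (J ⊕ J → ℝ) → J → ℝ := fun z => tardosProj fun i => z (Sum.inr i)
  have hX : Continuous X := tardosProj_continuous.comp (by fun_prop)
  have hY : Continuous Y := tardosProj_continuous.comp (by fun_prop)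
  have hXm : ∀ z ∈ stdSimplex ℝ (J ⊕ J), X z ∈ stdSimplex ℝ J :=
    fun z hz => tardosProj_mem _ fun i => hz.1 _
  have hYm : ∀ z ∈ stdSimplex ℝ (J ⊕ J), Y z ∈ stdSimplex ℝ J :=
    fun z hz => tardosProj_mem _ fun i => hz.1 _
  let f : (J ⊕ J → ℝ) → (J ⊕ J → ℝ) := fun z =>
    Sum.elim (fun i => g1 (X z) (Y z) i / 2) (fun i => g2 (X z) (Y z) i / 2)
  have hf : Continuous f := by
    have h1 : Continuous fun z => g1 (X z) (Y z) := hg1.comp (hX.prodMk hY)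
    have h2 : Continuous fun z => g2 (X z) (Y z) := hg2.comp (hX.prodMk hY)
    refine continuous_pi fun k => ?_
    rcases k with i | i
    · exact ((continuous_apply i).comp h1).div_const 2
    · exact ((continuous_apply i).comp h2).div_const 2
  have half : ∀ u ∈ stdSimplex ℝ J, ∀ w : J → ℝ, (∀ i, w i = u i / 2) → tardosProj w = u := by
    intro u hu w hw
    have hs : ∑ k, w k = 1 / 2 := by
      simp only [hw]; rw [← Finset.sum_div, hu.2]
    funext i
    simp only [tardosProj, hs, hw i]
    simp
  obtain ⟨z, hz, hfz⟩ := brouwer_simplex f hf (by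
    intro z hz
    have h1 := hm1 _ (hXm z hz) _ (hYm z hz)
    have h2 := hm2 _ (hXm z hz) _ (hYm z hz)
    refine ⟨?_, ?_⟩
    · rintro (i | i)
      · have := h1.1 i
        simp only [f, Sum.elim_inl]; positivity
      · have := h2.1 i
        simp only [f, Sum.elim_inr]; positivity
    · simp only [f, Fintype.sum_sum_type, Sum.elim_inl, Sum.elim_inr]
      rw [← Finset.sum_div, ← Finset.sum_div, h1.2, h2.2]; norm_num)
  refine ⟨X z, hXm z hz, Y z, hYm z hz, ?_, ?_⟩
  · exact (half _ (hm1 _ (hXm z hz) _ (hYm z hz)) _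
      fun i => (congrFun hfz (Sum.inl i)).symm).symm
  · exact (half _ (hm2 _ (hXm z hz) _ (hYm z hz)) _
      fun i => (congrFun hfz (Sum.inr i)).symm).symm

/-- The Nash type adjustment map. -/
noncomputable def nashMap {J : Type*} [Fintype J] (x d : J → ℝ) : J → ℝ := fun i =>
  (x i + max 0 (d i)) / (1 + ∑ k, max 0 (d k))

theorem nashMap_pos {J : Type*} [Fintype J] (d : J → ℝ) : 0 < 1 + ∑ k, max 0 (d k) := by
  have : 0 ≤ ∑ k, max 0 (d k) := Finset.sum_nonneg fun _ _ => le_max_left _ _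
  linarith

theorem nashMap_continuous {J : Type*} [Fintype J] :
    Continuous fun p : (J → ℝ) × (J → ℝ) => nashMap p.1 p.2 := by
  refine continuous_pi fun i => ?_
  unfold nashMap
  exact Continuous.div (by fun_prop) (by fun_prop) fun p => (nashMap_pos p.2).ne'

theorem nashMap_mem {J : Type*} [Fintype J] (x d : J → ℝ) (hx : x ∈ stdSimplex ℝ J) :
    nashMap x d ∈ stdSimplex ℝ J := by
  have hp := nashMap_pos d
  refine ⟨fun i => ?_, ?_⟩
  · have := hx.1 i
    unfold nashMap; positivity
  · unfold nashMap
    rw [← Finset.sum_div, Finset.sum_add_distrib, hx.2, div_self hp.ne']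

theorem nashMap_fixed {J : Type*} [Fintype J] (x r : J → ℝ) (W : ℝ) (hW : 0 < W)
    (hx : x ∈ stdSimplex ℝ J) (hr : ∑ i, r i = W) (hxr : ∀ i, x i = 0 → r i = 0)
    (hfix : nashMap x (fun i => W - Fintype.card J * r i) = x) :
    ∀ i, Fintype.card J * r i = W := by
  set d : J → ℝ := fun i => W - Fintype.card J * r i with hd
  have hp := nashMap_pos d
  have hsum : ∑ i, d i = 0 := by
    simp only [hd]
    rw [Finset.sum_sub_distrib, ← Finset.mul_sum, hr]; simp
  have heq : ∀ i, max 0 (d i) = x i * ∑ k, max 0 (d k) := by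
    intro i
    have := congrFun hfix i
    simp only [nashMap] at this
    rw [div_eq_iff hp.ne'] at this
    linarith
  have hS : 0 ≤ ∑ k, max 0 (d k) := Finset.sum_nonneg fun _ _ => le_max_left _ _
  have hle : ∀ i, d i ≤ 0 := by
    rcases hS.eq_or_lt with h0 | hpos
    · intro i
      have h1 := heq i
      rw [← h0, mul_zero] at h1
      have := le_max_right 0 (d i)
      linarith
    · exfalso
      have hxpos : ∀ i, 0 < d i := by
        intro i
        have hxi : x i ≠ 0 := by
          intro h
          have h1 := heq i
          rw [h, zero_mul] at h1
          have h2 := le_max_right 0 (d i)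
          have h3 : d i = W := by simp only [hd]; rw [hxr i h]; ring
          linarith
        have hxi' : 0 < x i := lt_of_le_of_ne (hx.1 i) (Ne.symm hxi)
        have h1 : 0 < max 0 (d i) := by rw [heq i]; positivity
        rcases lt_max_iff.mp h1 with h | h
        · exact absurd h (lt_irrefl _)
        · exact h
      have : Nonempty J := by
        by_contra hne
        rw [not_nonempty_iff] at hne
        simp at hr
        linarith
      have := Finset.sum_pos (fun i (_ : i ∈ Finset.univ) => hxpos i) Finset.univ_nonempty
      linarith
  intro i
  have := (Finset.sum_eq_zero_iff_of_nonpos fun i _ => hle i).mp hsum i (Finset.mem_univ i)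
  simp only [hd] at this
  linarith

/-- A colourful-type balancing theorem on a product of two simplices. -/
theorem balanced_perm {J : Type*} [Fintype J] [DecidableEq J] [Nonempty J]
    (w : J → J → (J → ℝ) → (J → ℝ) → ℝ)
    (hw : ∀ i j, Continuous fun p : (J → ℝ) × (J → ℝ) => w i j p.1 p.2)
    (hw0 : ∀ i j x y, 0 ≤ w i j x y)
    (hx0 : ∀ i j x y, x i = 0 → w i j x y = 0)
    (hy0 : ∀ i j x y, y j = 0 → w i j x y = 0)
    (hpos : ∀ x ∈ stdSimplex ℝ J, ∀ y ∈ stdSimplex ℝ J, ∃ i j, 0 < w i j x y) :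
    ∃ x ∈ stdSimplex ℝ J, ∃ y ∈ stdSimplex ℝ J, ∃ σ : Equiv.Perm J, ∀ i, 0 < w i (σ i) x y := by
  let W : (J → ℝ) → (J → ℝ) → ℝ := fun x y => ∑ i, ∑ j, w i j x y
  have hWc : Continuous fun p : (J → ℝ) × (J → ℝ) => W p.1 p.2 :=
    continuous_finsetSum _ fun i _ => continuous_finsetSum _ fun j _ => hw i j
  have hd1 : Continuous fun p : (J → ℝ) × (J → ℝ) =>
      (fun i => W p.1 p.2 - Fintype.card J * ∑ j, w i j p.1 p.2) :=
    continuous_pi fun i => hWc.sub (continuous_const.mul (continuous_finsetSum _ fun j _ => hw i j))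
  have hd2 : Continuous fun p : (J → ℝ) × (J → ℝ) =>
      (fun j => W p.1 p.2 - Fintype.card J * ∑ i, w i j p.1 p.2) :=
    continuous_pi fun j => hWc.sub (continuous_const.mul (continuous_finsetSum _ fun i _ => hw i j))
  obtain ⟨x, hx, y, hy, h1, h2⟩ := brouwer_prod
    (fun x y => nashMap x fun i => W x y - Fintype.card J * ∑ j, w i j x y)
    (fun x y => nashMap y fun j => W x y - Fintype.card J * ∑ i, w i j x y)
    (nashMap_continuous.comp (continuous_fst.prodMk hd1))
    (nashMap_continuous.comp (continuous_snd.prodMk hd2))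
    (fun x hx y hy => nashMap_mem _ _ hx) (fun x hx y hy => nashMap_mem _ _ hy)
  refine ⟨x, hx, y, hy, ?_⟩
  have hW : 0 < W x y := by
    obtain ⟨i, j, hij⟩ := hpos x hx y hy
    have h3 : w i j x y ≤ ∑ j, w i j x y :=
      Finset.single_le_sum (f := fun j => w i j x y) (fun j _ => hw0 i j x y) (Finset.mem_univ j)
    have h4 : ∑ j, w i j x y ≤ W x y :=
      Finset.single_le_sum (f := fun i => ∑ j, w i j x y)
        (fun i _ => Finset.sum_nonneg fun j _ => hw0 i j x y) (Finset.mem_univ i)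
    linarith
  have hr := nashMap_fixed x (fun i => ∑ j, w i j x y) (W x y) hW hx rfl
    (fun i hi => Finset.sum_eq_zero fun j _ => hx0 i j x y hi) h1
  have hc := nashMap_fixed y (fun j => ∑ i, w i j x y) (W x y) hW hy Finset.sum_comm
    (fun j hj => Finset.sum_eq_zero fun i _ => hy0 i j x y hj) h2
  let M : Matrix J J ℝ := Matrix.of fun i j => Fintype.card J * w i j x y / W x y
  have hM : M ∈ doublyStochastic ℝ J := by
    rw [mem_doublyStochastic_iff_sum]
    refine ⟨fun i j => ?_, fun i => ?_, fun j => ?_⟩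
    · have := hw0 i j x y
      simp only [M, Matrix.of_apply]; positivity
    · simp only [M, Matrix.of_apply]
      rw [← Finset.sum_div, ← Finset.mul_sum, hr i, div_self hW.ne']
    · simp only [M, Matrix.of_apply]
      rw [← Finset.sum_div, ← Finset.mul_sum, hc j, div_self hW.ne']
  obtain ⟨α, hα0, hα1, hαM⟩ := exists_eq_sum_perm_of_mem_doublyStochastic hM
  obtain ⟨σ, -, hσ⟩ : ∃ σ ∈ (Finset.univ : Finset (Equiv.Perm J)), 0 < α σ := by
    apply Finset.exists_lt_of_sum_lt
    rw [hα1]; simp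
  refine ⟨σ, fun i => ?_⟩
  have h5 : 0 < M i (σ i) := by
    rw [← hαM, Matrix.sum_apply]
    refine lt_of_lt_of_le ?_ (Finset.single_le_sum
      (f := fun τ => (α τ • Equiv.Perm.permMatrix ℝ τ) i (σ i)) (fun τ _ => ?_)
      (Finset.mem_univ σ))
    · simp [Matrix.smul_apply, Equiv.Perm.permMatrix, PEquiv.toMatrix_apply, hσ]
    · have := hα0 τ
      simp only [Matrix.smul_apply, Equiv.Perm.permMatrix, PEquiv.toMatrix_apply, smul_eq_mul]
      positivity
  refine lt_of_le_of_ne (hw0 _ _ _ _) fun h => ?_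
  simp only [M, Matrix.of_apply, ← h] at h5
  simp at h5

/-- Cut points determined by a point of the simplex. -/
noncomputable def cutPt (n : ℕ) (M : ℝ) (x : Fin n → ℝ) (k : ℕ) : ℝ :=
  -M + 2 * M * ∑ j : Fin n, if j.val < k then x j else 0

theorem cutPt_continuous (n : ℕ) (M : ℝ) (k : ℕ) : Continuous fun x => cutPt n M x k := by
  unfold cutPt
  refine continuous_const.add (continuous_const.mul (continuous_finsetSum _ fun j _ => ?_))
  split_ifs
  · exact continuous_apply j
  · exact continuous_const

theorem cutPt_zero (n : ℕ) (M : ℝ) (x : Fin n → ℝ) : cutPt n M x 0 = -M := by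
  simp [cutPt]

theorem cutPt_last (n : ℕ) (M : ℝ) (x : Fin n → ℝ) (hx : x ∈ stdSimplex ℝ (Fin n)) :
    cutPt n M x n = M := by
  have : ∑ j : Fin n, (if j.val < n then x j else 0) = 1 := by
    rw [← hx.2]
    exact Finset.sum_congr rfl fun j _ => if_pos j.2
  rw [cutPt, this]; ring

theorem cutPt_mono (n : ℕ) (M : ℝ) (hM : 0 ≤ M) (x : Fin n → ℝ) (hx : x ∈ stdSimplex ℝ (Fin n)) :
    Monotone (cutPt n M x) := by
  intro k l hkl
  unfold cutPt
  gcongr with j _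
  have := hx.1 j
  split_ifs
  · exact le_rfl
  · omega
  · exact this
  · exact le_rfl

theorem cutPt_succ (n : ℕ) (M : ℝ) (x : Fin n → ℝ) (i : Fin n) (hi : x i = 0) :
    cutPt n M x (i.val + 1) = cutPt n M x i.val := by
  unfold cutPt
  congr 2
  refine Finset.sum_congr rfl fun j _ => ?_
  by_cases hj : j = i
  · subst hj; simp [hi]
  · have : j.val ≠ i.val := fun h => hj (Fin.ext h)
    have h2 : (j.val < i.val + 1) ↔ (j.val < i.val) := by omega
    simp only [h2]

/-- How deep the interval `[s, t]` sits inside the `i`-th piece. -/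
noncomputable def depth (n : ℕ) (M s t : ℝ) (x : Fin n → ℝ) (i : Fin n) : ℝ :=
  max 0 (min (s - cutPt n M x i.val) (cutPt n M x (i.val + 1) - t))

theorem depth_continuous (n : ℕ) (M s t : ℝ) (i : Fin n) :
    Continuous fun x => depth n M s t x i := by
  have h1 := cutPt_continuous n M i.val
  have h2 := cutPt_continuous n M (i.val + 1)
  unfold depth
  fun_prop

theorem depth_nonneg (n : ℕ) (M s t : ℝ) (x : Fin n → ℝ) (i : Fin n) : 0 ≤ depth n M s t x i :=
  le_max_left _ _

theorem depth_pos_iff (n : ℕ) (M s t : ℝ) (x : Fin n → ℝ) (i : Fin n) :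
    0 < depth n M s t x i ↔ cutPt n M x i.val < s ∧ t < cutPt n M x (i.val + 1) := by
  unfold depth
  rw [lt_max_iff, lt_min_iff, sub_pos, sub_pos]
  simp

theorem depth_zero (n : ℕ) (M s t : ℝ) (hst : s < t) (x : Fin n → ℝ) (i : Fin n) (hi : x i = 0) :
    depth n M s t x i = 0 := by
  by_contra h
  have h' := (depth_pos_iff n M s t x i).mp (lt_of_le_of_ne (depth_nonneg _ _ _ _ _ _) (Ne.symm h))
  rw [cutPt_succ n M x i hi] at h'
  linarith [h'.1, h'.2]

theorem exists_piece (m : ℕ) (M s t : ℝ) (hst : s < t) (hs : -M < s) (ht : t < M)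
    (x : Fin (m + 1) → ℝ) (hx : x ∈ stdSimplex ℝ (Fin (m + 1)))
    (hun : ∀ k : Fin m, ¬ (s ≤ cutPt (m + 1) M x (k.val + 1) ∧ cutPt (m + 1) M x (k.val + 1) ≤ t)) :
    ∃ i, 0 < depth (m + 1) M s t x i := by
  classical
  have hex : ∃ k, s ≤ cutPt (m + 1) M x k := ⟨m + 1, by rw [cutPt_last _ _ _ hx]; linarith⟩
  set k := Nat.find hex with hk
  have hk1 : s ≤ cutPt (m + 1) M x k := Nat.find_spec hex
  have hk2 : k ≤ m + 1 := Nat.find_min' hex (by rw [cutPt_last _ _ _ hx]; linarith)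
  have hk0 : k ≠ 0 := by
    intro h
    rw [h, cutPt_zero] at hk1
    linarith
  obtain ⟨l, hl⟩ := Nat.exists_eq_succ_of_ne_zero hk0
  have hlt : cutPt (m + 1) M x l < s := not_le.mp (Nat.find_min hex (by omega))
  rw [hl, Nat.succ_eq_add_one] at hk1
  refine ⟨⟨l, by omega⟩, (depth_pos_iff _ _ _ _ _ _).mpr ⟨hlt, ?_⟩⟩
  by_cases hlm : l = m
  · subst hlm
    simp only
    rw [cutPt_last _ _ _ hx]; exact ht
  · have := hun ⟨l, by omega⟩
    simp only [not_and, not_le] at this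
    exact this hk1

theorem depth_sep (n : ℕ) (M : ℝ) (hM : 0 ≤ M) (s t s' t' : ℝ) (x : Fin n → ℝ)
    (hx : x ∈ stdSimplex ℝ (Fin n)) (i i' : Fin n) (hne : i ≠ i')
    (h : 0 < depth n M s t x i) (h' : 0 < depth n M s' t' x i') : t < s' ∨ t' < s := by
  rw [depth_pos_iff] at h h'
  rcases lt_or_gt_of_ne hne with hlt | hlt
  · left
    have : cutPt n M x (i.val + 1) ≤ cutPt n M x i'.val := cutPt_mono n M hM x hx hlt
    linarith [h.2, h'.1]
  · right
    have : cutPt n M x (i'.val + 1) ≤ cutPt n M x i.val := cutPt_mono n M hM x hx hlt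
    linarith [h'.2, h.1]

/-- Tardos theorem for rectangles (closed version). -/
theorem tardos (N m : ℕ) (R : Fin N → Rect)
    (h : ∀ S : Finset (Fin N),
      (∀ i ∈ S, ∀ j ∈ S, i ≠ j → Rect.Indep (R i) (R j)) → S.card ≤ m) :
    ∃ a b : Fin m → ℝ, ∀ r, (∃ k, (R r).x1 ≤ a k ∧ a k ≤ (R r).x2) ∨
      (∃ k, (R r).y1 ≤ b k ∧ b k ≤ (R r).y2) := by
  classical
  obtain ⟨M, hM0, hM⟩ : ∃ M : ℝ, 0 ≤ M ∧ ∀ r, -M < (R r).x1 ∧ (R r).x2 < M ∧ -M < (R r).y1 ∧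
      (R r).y2 < M := by
    let F : Fin N → ℝ := fun r => |(R r).x1| + |(R r).x2| + |(R r).y1| + |(R r).y2|
    have hF : ∀ r, 0 ≤ F r := fun r => by positivity
    refine ⟨∑ r, F r + 1, by have := Finset.sum_nonneg fun r (_ : r ∈ Finset.univ) => hF r
                             linarith, fun r => ?_⟩
    have h1 : F r ≤ ∑ r, F r := Finset.single_le_sum (fun r _ => hF r) (Finset.mem_univ r)
    have h2 : |(R r).x1| + |(R r).x2| + |(R r).y1| + |(R r).y2| ≤ ∑ r, F r := h1
    have e1 := abs_nonneg (R r).x1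
    have e2 := abs_nonneg (R r).x2
    have e3 := abs_nonneg (R r).y1
    have e4 := abs_nonneg (R r).y2
    have f1 := neg_abs_le (R r).x1
    have f2 := le_abs_self (R r).x2
    have f3 := neg_abs_le (R r).y1
    have f4 := le_abs_self (R r).y2
    refine ⟨?_, ?_, ?_, ?_⟩ <;> linarith
  by_contra hcon
  push Not at hcon
  let w : Fin (m + 1) → Fin (m + 1) → (Fin (m + 1) → ℝ) → (Fin (m + 1) → ℝ) → ℝ := fun i j x y =>
    ∑ r, depth (m + 1) M (R r).x1 (R r).x2 x i * depth (m + 1) M (R r).y1 (R r).y2 y j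
  obtain ⟨x, hx, y, hy, σ, hσ⟩ := balanced_perm w
    (fun i j => continuous_finsetSum _ fun r _ =>
      ((depth_continuous _ _ _ _ _).comp continuous_fst).mul
        ((depth_continuous _ _ _ _ _).comp continuous_snd))
    (fun i j x y => Finset.sum_nonneg fun r _ =>
      mul_nonneg (depth_nonneg _ _ _ _ _ _) (depth_nonneg _ _ _ _ _ _))
    (fun i j x y hi => Finset.sum_eq_zero fun r _ => by
      rw [depth_zero _ _ _ _ (R r).hx _ _ hi, zero_mul])
    (fun i j x y hi => Finset.sum_eq_zero fun r _ => by
      rw [depth_zero _ _ _ _ (R r).hy _ _ hi, mul_zero])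
    (by
      intro x hx y hy
      obtain ⟨r, hr1, hr2⟩ := hcon (fun k => cutPt (m + 1) M x (k.val + 1))
        (fun k => cutPt (m + 1) M y (k.val + 1))
      obtain ⟨i, hi⟩ := exists_piece m M _ _ (R r).hx (hM r).1 (hM r).2.1 x hx
        (fun k hk => absurd hk.2 (not_le.mpr (hr1 k hk.1)))
      obtain ⟨j, hj⟩ := exists_piece m M _ _ (R r).hy (hM r).2.2.1 (hM r).2.2.2 y hy
        (fun k hk => absurd hk.2 (not_le.mpr (hr2 k hk.1)))
      exact ⟨i, j, lt_of_lt_of_le (mul_pos hi hj) (Finset.single_le_sum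
        (f := fun r => depth (m + 1) M (R r).x1 (R r).x2 x i *
          depth (m + 1) M (R r).y1 (R r).y2 y j)
        (fun r _ => mul_nonneg (depth_nonneg _ _ _ _ _ _) (depth_nonneg _ _ _ _ _ _))
        (Finset.mem_univ r))⟩)
  have hpick : ∀ i, ∃ r, 0 < depth (m + 1) M (R r).x1 (R r).x2 x i ∧
      0 < depth (m + 1) M (R r).y1 (R r).y2 y (σ i) := by
    intro i
    by_contra hno
    push Not at hno
    refine (hσ i).ne' (Finset.sum_eq_zero fun r _ => ?_)
    rcases (depth_nonneg (m + 1) M (R r).x1 (R r).x2 x i).eq_or_lt with h0 | h0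
    · rw [← h0, zero_mul]
    · rw [le_antisymm (hno r h0) (depth_nonneg _ _ _ _ _ _), mul_zero]
  choose ρ hρ1 hρ2 using hpick
  have hind : ∀ i i', i ≠ i' → Rect.Indep (R (ρ i)) (R (ρ i')) := fun i i' hne =>
    ⟨depth_sep _ M hM0 _ _ _ _ x hx i i' hne (hρ1 i) (hρ1 i'),
      depth_sep _ M hM0 _ _ _ _ y hy (σ i) (σ i') (fun h => hne (σ.injective h)) (hρ2 i) (hρ2 i')⟩
  have hρinj : Function.Injective ρ := by
    intro i i' heq
    by_contra hne
    have h1 := (hind i i' hne).1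
    rw [heq] at h1
    have h2 := (R (ρ i')).hx
    rcases h1 with h1 | h1 <;> linarith
  have hcard := h (Finset.univ.image ρ) (by
    intro a ha b hb hab
    obtain ⟨i, _, rfl⟩ := Finset.mem_image.mp ha
    obtain ⟨i', _, rfl⟩ := Finset.mem_image.mp hb
    exact hind i i' fun h => hab (by rw [h]))
  rw [Finset.card_image_of_injective _ hρinj, Finset.card_univ, Fintype.card_fin] at hcard
  omega

/-- If a finite collection of closed axis-parallel rectangles has
independence number at most `m`, then some `4m` vertical and horizontal
lines slice the interior of every rectangle in the collection. -/
theorem rectangles_sliced_by_lines (N m : ℕ) (R : Fin N → Rect)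
    (h : ∀ S : Finset (Fin N),
      (∀ i ∈ S, ∀ j ∈ S, i ≠ j → Rect.Indep (R i) (R j)) → S.card ≤ m) :
    ∃ L : Finset (Bool × ℝ), L.card ≤ 4 * m ∧ ∀ i, ∃ l ∈ L, Slices l (R i) := by
  classical
  obtain ⟨a, b, hab⟩ := tardos N m R h
  obtain ⟨ε, hε, hεR⟩ : ∃ ε : ℝ, 0 < ε ∧ ∀ r, 2 * ε < (R r).x2 - (R r).x1 ∧
      2 * ε < (R r).y2 - (R r).y1 := by
    rcases isEmpty_or_nonempty (Fin N) with hE | hE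
    · exact ⟨1, one_pos, fun r => hE.elim r⟩
    obtain ⟨r0, hr0⟩ := Finite.exists_min fun r : Fin N =>
      min ((R r).x2 - (R r).x1) ((R r).y2 - (R r).y1)
    have hpos : 0 < min ((R r0).x2 - (R r0).x1) ((R r0).y2 - (R r0).y1) :=
      lt_min (sub_pos.mpr (R r0).hx) (sub_pos.mpr (R r0).hy)
    refine ⟨min ((R r0).x2 - (R r0).x1) ((R r0).y2 - (R r0).y1) / 4, by linarith, fun r => ?_⟩
    have h1 := (hr0 r).trans (min_le_left _ _)
    have h2 := (hr0 r).trans (min_le_right _ _)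
    constructor <;> linarith
  have hshift : ∀ s t p : ℝ, 2 * ε < t - s → s ≤ p → p ≤ t →
      ∃ δ : Bool, s < p + (if δ then ε else -ε) ∧ p + (if δ then ε else -ε) < t := by
    intro s t p hst h1 h2
    by_cases hp : p + ε < t
    · exact ⟨true, by simp only [if_true]; linarith, by simpa using hp⟩
    · exact ⟨false, by simp; linarith, by simp; linarith⟩
  let g : Bool × Bool × Fin m → Bool × ℝ := fun q =>
    (q.1, (if q.1 then b q.2.2 else a q.2.2) + if q.2.1 then ε else -ε)
  refine ⟨Finset.univ.image g, ?_, fun r => ?_⟩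
  · refine Finset.card_image_le.trans ?_
    rw [Finset.card_univ]
    simp only [Fintype.card_prod, Fintype.card_bool, Fintype.card_fin]
    omega
  · rcases hab r with ⟨k, h1, h2⟩ | ⟨k, h1, h2⟩
    · obtain ⟨δ, hδ⟩ := hshift _ _ _ (hεR r).1 h1 h2
      exact ⟨g (false, δ, k), Finset.mem_image_of_mem _ (Finset.mem_univ _), by
        simpa [g, Slices] using hδ⟩
    · obtain ⟨δ, hδ⟩ := hshift _ _ _ (hεR r).2 h1 h2
      exact ⟨g (true, δ, k), Finset.mem_image_of_mem _ (Finset.mem_univ _), by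
        simpa [g, Slices] using hδ⟩
end

section
/- If a permutation class avoids both ⊕^k(k...21) and ⊖^k(12...k), then every permutation in the class can be expressed as the merge of at most 8k³ monotone permutations; equivalently, the class is contained in the merge of at most 8k³ monotone classes. -/
/-- `π` contains the pattern given (in one-line, 0-indexed form) by
`p : Fin m → ℕ`. -/
def ContainsPattern {n m : ℕ} (p : Fin m → ℕ) (π : Equiv.Perm (Fin n)) : Prop :=
  ∃ f : Fin m → Fin n, StrictMono f ∧ ∀ i j, p i < p j ↔ π (f i) < π (f j)

/-- The layered permutation `⊕^k(k...21)` of length `k²` (0-indexed). -/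
def LayeredFun (k : ℕ) (i : Fin (k * k)) : ℕ :=
  k * ((i : ℕ) / k) + (k - 1 - (i : ℕ) % k)

/-- The colayered permutation `⊖^k(12...k)` of length `k²` (0-indexed). -/
def ColayeredFun (k : ℕ) (i : Fin (k * k)) : ℕ :=
  k * (k - 1 - (i : ℕ) / k) + (i : ℕ) % k

/-- Mirsky-type level function: a transitive relation with no chain of length `k+1` has `k` levels. -/
theorem levels_aux {α : Type*} (R : α → α → Prop) (k : ℕ) : ∀ (S : Set α),
    (∀ a b c, b ∈ S → R a b → R b c → R a c) →
    (¬ ∃ f : Fin (k + 1) → α, (∀ i, f i ∈ S) ∧ ∀ i j, i < j → R (f i) (f j)) →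
    ∃ L : α → ℕ, (∀ a ∈ S, L a < k) ∧ ∀ a ∈ S, ∀ b ∈ S, R a b → L a < L b := by
  classical
  induction k with
  | zero =>
    intro S _ h
    have hS : ∀ a, a ∉ S := by
      intro a ha
      apply h
      refine ⟨fun _ => a, fun _ => ha, ?_⟩
      intro i j hij
      omega
    exact ⟨fun _ => 0, fun a ha => absurd ha (hS a), fun a ha => absurd ha (hS a)⟩
  | succ k ih =>
    intro S tr h
    obtain ⟨L, hL1, hL2⟩ := ih {a | a ∈ S ∧ ∃ b ∈ S, R b a}
      (fun a b c hb => tr a b c hb.1) (by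
        rintro ⟨f, hf, hf2⟩
        obtain ⟨b, hb, hb2⟩ := (hf 0).2
        apply h
        refine ⟨Fin.cons b f, ?_, ?_⟩
        · intro i
          refine Fin.cases ?_ (fun i => ?_) i
          · simpa using hb
          · simpa using (hf i).1
        · intro i j
          refine Fin.cases ?_ (fun i => ?_) i <;> refine Fin.cases ?_ (fun j => ?_) j
          · intro hij
            exact absurd hij (lt_irrefl _)
          · intro _
            simp only [Fin.cons_zero, Fin.cons_succ]
            by_cases hj : j = 0
            · rw [hj]; exact hb2
            · exact tr _ (f 0) _ (hf 0).1 hb2 (hf2 0 j (Fin.pos_of_ne_zero hj))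
          · intro hij
            exact absurd hij (Fin.not_lt_zero _)
          · intro hij
            simp only [Fin.cons_succ]
            exact hf2 i j (Fin.succ_lt_succ_iff.1 hij))
    refine ⟨fun a => if (∃ b ∈ S, R b a) then L a + 1 else 0, ?_, ?_⟩
    · intro a ha
      dsimp only
      split_ifs with h1
      · have := hL1 a ⟨ha, h1⟩
        omega
      · omega
    · intro a ha b hb hab
      have h2 : ∃ c ∈ S, R c b := ⟨a, ha, hab⟩
      dsimp only
      rw [if_pos h2]
      split_ifs with h1
      · have := hL2 a ⟨ha, h1⟩ b ⟨hb, h2⟩ hab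
        omega
      · omega

/-- Axis-parallel rectangles `[l,r] × [b,t]`. -/
structure Rct where
  l : ℕ
  r : ℕ
  b : ℕ
  t : ℕ

/-- A family of pairwise (line-)intersecting rectangles is pierced by three lines. -/
theorem three_lines (S : Set Rct)
    (hS : ∀ A ∈ S, ∀ B ∈ S, (A.l ≤ B.r ∧ B.l ≤ A.r) ∨ (A.b ≤ B.t ∧ B.b ≤ A.t)) :
    ∃ x y z : ℕ, ∀ A ∈ S, (A.l ≤ x ∧ x ≤ A.r) ∨ (A.b ≤ y ∧ y ≤ A.t) ∨ (A.b ≤ z ∧ z ≤ A.t) := by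
  classical
  -- one-dimensional Helly
  have helly : ∀ U : Set Rct, (∀ A ∈ U, ∀ B ∈ U, A.b ≤ B.t) →
      ∃ y, ∀ A ∈ U, A.b ≤ y ∧ y ≤ A.t := by
    intro U hU
    by_cases hne : ∃ y, ∃ A ∈ U, A.t = y
    · refine ⟨Nat.find hne, fun A hA => ?_⟩
      obtain ⟨B, hB, hB2⟩ := Nat.find_spec hne
      have h1 := Nat.find_min' hne ⟨A, hA, rfl⟩
      have h2 := hU A hA B hB
      omega
    · exact ⟨0, fun A hA => absurd ⟨_, A, hA, rfl⟩ hne⟩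
  by_cases hne : ∃ x, ∃ P ∈ S, ∃ Q ∈ S, P.t < Q.b ∧ P.r ≤ x ∧ Q.r ≤ x
  · obtain ⟨P, hP, Q, hQ, hPQ, h1, h2⟩ := Nat.find_spec hne
    have hmin : ∀ y, y < Nat.find hne → _ := fun y hy => Nat.find_min hne hy
    generalize Nat.find hne = x at *
    obtain ⟨y, hy⟩ := helly {A | A ∈ S ∧ A.r < x} (by
      rintro A ⟨hA, hA2⟩ B ⟨hB, hB2⟩
      by_contra hcon
      exact hmin (x - 1) (by omega) ⟨B, hB, A, hA, by omega, by omega, by omega⟩)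
    refine ⟨x, y, P.t, fun A hA => ?_⟩
    by_cases hr : A.r < x
    · exact Or.inr (Or.inl (hy A ⟨hA, hr⟩))
    · have h3 := hS A hA P hP
      have h4 := hS A hA Q hQ
      omega
  · obtain ⟨y, hy⟩ := helly S (by
      intro A hA B hB
      by_contra hcon
      exact hne ⟨A.r + B.r, B, hB, A, hA, by omega, by omega, by omega⟩)
    exact ⟨0, y, 0, fun A hA => Or.inr (Or.inl (hy A hA))⟩

/-- Given `m + 1` blocks in increasing position, each decreasing of length `m + 1`,
we find the layered pattern. -/
theorem layered_of_blocks {n m : ℕ} (π : Equiv.Perm (Fin n)) (d : Fin (m + 1) → Fin (m + 1) → Fin n)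
    (h1 : ∀ a i j, i < j → d a i < d a j ∧ π (d a j) < π (d a i))
    (h2 : ∀ a b, a < b → ∀ i j, d a i < d b j ∧ π (d a i) < π (d b j)) :
    ContainsPattern (LayeredFun (m + 1)) π := by
  have hq : ∀ a : Fin ((m + 1) * (m + 1)), (a : ℕ) / (m + 1) < m + 1 := fun a =>
    Nat.div_lt_of_lt_mul a.2
  have hr : ∀ a : Fin ((m + 1) * (m + 1)), (a : ℕ) % (m + 1) < m + 1 := fun a =>
    Nat.mod_lt _ (Nat.succ_pos _)
  set f : Fin ((m + 1) * (m + 1)) → Fin n := fun a => d ⟨_, hq a⟩ ⟨_, hr a⟩ with hf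
  have key : ∀ a b, a < b → f a < f b ∧
      ((LayeredFun (m + 1) a < LayeredFun (m + 1) b ∧ π (f a) < π (f b)) ∨
       (LayeredFun (m + 1) b < LayeredFun (m + 1) a ∧ π (f b) < π (f a))) := by
    intro a b hab
    have hab' : (a : ℕ) < b := hab
    have ha := Nat.div_add_mod (a : ℕ) (m + 1)
    have hb := Nat.div_add_mod (b : ℕ) (m + 1)
    have hle : (a : ℕ) / (m + 1) ≤ b / (m + 1) := Nat.div_le_div_right hab'.le
    rcases hle.lt_or_eq with hlt | heq
    · have := h2 ⟨_, hq a⟩ ⟨_, hq b⟩ hlt ⟨_, hr a⟩ ⟨_, hr b⟩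
      refine ⟨this.1, Or.inl ⟨?_, this.2⟩⟩
      unfold LayeredFun
      have h3 : (m + 1) * ((a : ℕ) / (m + 1) + 1) ≤ (m + 1) * (b / (m + 1)) :=
        Nat.mul_le_mul_left _ hlt
      rw [mul_add, mul_one] at h3
      omega
    · have hmod : (a : ℕ) % (m + 1) < b % (m + 1) := by
        rw [heq] at ha
        omega
      have := h1 ⟨_, hq a⟩ ⟨_, hr a⟩ ⟨_, hr b⟩ hmod
      have he : (⟨_, hq a⟩ : Fin (m + 1)) = ⟨_, hq b⟩ := Fin.ext heq
      have hfb : f b = d ⟨_, hq a⟩ ⟨_, hr b⟩ := by rw [he]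
      rw [hfb]
      refine ⟨this.1, Or.inr ⟨?_, this.2⟩⟩
      unfold LayeredFun
      have := hr b
      rw [heq]
      omega
  refine ⟨f, fun a b hab => (key a b hab).1, fun a b => ?_⟩
  rcases lt_trichotomy a b with h | h | h
  · rcases (key a b h).2 with h | h
    · exact ⟨fun _ => h.2, fun _ => h.1⟩
    · exact ⟨fun h' => absurd h' h.1.asymm, fun h' => absurd h' h.2.asymm⟩
  · subst h
    exact ⟨fun h' => absurd h' (lt_irrefl _), fun h' => absurd h' (lt_irrefl _)⟩
  · rcases (key b a h).2 with h | h
    · exact ⟨fun h' => absurd h' h.1.asymm, fun h' => absurd h' h.2.asymm⟩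
    · exact ⟨fun _ => h.2, fun _ => h.1⟩

/-- Given `m + 1` blocks in decreasing position, each increasing of length `m + 1`,
we find the colayered pattern. -/
theorem colayered_of_blocks {n m : ℕ} (π : Equiv.Perm (Fin n)) (d : Fin (m + 1) → Fin (m + 1) → Fin n)
    (h1 : ∀ a i j, i < j → d a i < d a j ∧ π (d a i) < π (d a j))
    (h2 : ∀ a b, a < b → ∀ i j, d a i < d b j ∧ π (d b j) < π (d a i)) :
    ContainsPattern (ColayeredFun (m + 1)) π := by
  have hq : ∀ a : Fin ((m + 1) * (m + 1)), (a : ℕ) / (m + 1) < m + 1 := fun a =>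
    Nat.div_lt_of_lt_mul a.2
  have hr : ∀ a : Fin ((m + 1) * (m + 1)), (a : ℕ) % (m + 1) < m + 1 := fun a =>
    Nat.mod_lt _ (Nat.succ_pos _)
  set f : Fin ((m + 1) * (m + 1)) → Fin n := fun a => d ⟨_, hq a⟩ ⟨_, hr a⟩ with hf
  have key : ∀ a b, a < b → f a < f b ∧
      ((ColayeredFun (m + 1) a < ColayeredFun (m + 1) b ∧ π (f a) < π (f b)) ∨
       (ColayeredFun (m + 1) b < ColayeredFun (m + 1) a ∧ π (f b) < π (f a))) := by
    intro a b hab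
    have hab' : (a : ℕ) < b := hab
    have ha := Nat.div_add_mod (a : ℕ) (m + 1)
    have hb := Nat.div_add_mod (b : ℕ) (m + 1)
    have hle : (a : ℕ) / (m + 1) ≤ b / (m + 1) := Nat.div_le_div_right hab'.le
    rcases hle.lt_or_eq with hlt | heq
    · have := h2 ⟨_, hq a⟩ ⟨_, hq b⟩ hlt ⟨_, hr a⟩ ⟨_, hr b⟩
      refine ⟨this.1, Or.inr ⟨?_, this.2⟩⟩
      unfold ColayeredFun
      have hqb := hq b
      have hra := hr a
      have hrb := hr b
      have h3 : (m + 1) * ((m + 1 - 1 - (b : ℕ) / (m + 1)) + 1) ≤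
          (m + 1) * (m + 1 - 1 - (a : ℕ) / (m + 1)) :=
        Nat.mul_le_mul_left _ (by omega)
      rw [mul_add, mul_one] at h3
      omega
    · have hmod : (a : ℕ) % (m + 1) < b % (m + 1) := by
        rw [heq] at ha
        omega
      have := h1 ⟨_, hq a⟩ ⟨_, hr a⟩ ⟨_, hr b⟩ hmod
      have he : (⟨_, hq a⟩ : Fin (m + 1)) = ⟨_, hq b⟩ := Fin.ext heq
      have hfb : f b = d ⟨_, hq a⟩ ⟨_, hr b⟩ := by rw [he]
      rw [hfb]
      refine ⟨this.1, Or.inl ⟨?_, this.2⟩⟩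
      unfold ColayeredFun
      have := hr b
      rw [heq]
      omega
  refine ⟨f, fun a b hab => (key a b hab).1, fun a b => ?_⟩
  rcases lt_trichotomy a b with h | h | h
  · rcases (key a b h).2 with h | h
    · exact ⟨fun _ => h.2, fun _ => h.1⟩
    · exact ⟨fun h' => absurd h' h.1.asymm, fun h' => absurd h' h.2.asymm⟩
  · subst h
    exact ⟨fun h' => absurd h' (lt_irrefl _), fun h' => absurd h' (lt_irrefl _)⟩
  · rcases (key b a h).2 with h | h
    · exact ⟨fun h' => absurd h' h.1.asymm, fun h' => absurd h' h.2.asymm⟩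
    · exact ⟨fun _ => h.2, fun _ => h.1⟩

/-- `F` is the set of rectangles containing both a decreasing and an increasing
sequence of length `m + 1`. -/
def BadRct {n : ℕ} (m : ℕ) (π : Equiv.Perm (Fin n)) : Set Rct :=
  {A | (∃ d : Fin (m + 1) → Fin n, (∀ i j, i < j → d i < d j ∧ π (d j) < π (d i)) ∧
        ∀ i, A.l ≤ (d i : ℕ) ∧ (d i : ℕ) ≤ A.r ∧ A.b ≤ (π (d i) : ℕ) ∧ (π (d i) : ℕ) ≤ A.t) ∧
       (∃ d : Fin (m + 1) → Fin n, (∀ i j, i < j → d i < d j ∧ π (d i) < π (d j)) ∧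
        ∀ i, A.l ≤ (d i : ℕ) ∧ (d i : ℕ) ≤ A.r ∧ A.b ≤ (π (d i) : ℕ) ∧ (π (d i) : ℕ) ≤ A.t)}

/-- All bad rectangles are pierced by few lines. -/
theorem bad_pierced {n m : ℕ} (π : Equiv.Perm (Fin n))
    (h₁ : ¬ ContainsPattern (LayeredFun (m + 1)) π)
    (h₂ : ¬ ContainsPattern (ColayeredFun (m + 1)) π) :
    ∃ (X : Fin m × Fin m → ℕ) (Y : (Fin m × Fin m) ⊕ (Fin m × Fin m) → ℕ),
      ∀ A ∈ BadRct m π, (∃ i, A.l ≤ X i ∧ X i ≤ A.r) ∨ (∃ i, A.b ≤ Y i ∧ Y i ≤ A.t) := by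
  have hval : ∀ A ∈ BadRct m π, A.l ≤ A.r ∧ A.b ≤ A.t := by
    rintro A ⟨⟨d, _, hd⟩, _⟩
    have := hd 0
    omega
  obtain ⟨L, hL1, hL2⟩ := levels_aux (fun A B : Rct => A.r < B.l ∧ A.t < B.b) m (BadRct m π)
    (by
      intro A B C hB hAB hBC
      have := hval B hB
      try dsimp only at *
      omega)
    (by
      rintro ⟨f, hf, hf2⟩
      choose d hd1 hd2 using fun i => (hf i).1
      refine h₁ (layered_of_blocks π d hd1 ?_)
      intro a b hab i j
      have h3 := hf2 a b hab
      have h4 := hd2 a i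
      have h5 := hd2 b j
      simp only [Fin.lt_def]
      try dsimp only at h3
      omega)
  obtain ⟨M, hM1, hM2⟩ := levels_aux (fun A B : Rct => A.r < B.l ∧ B.t < A.b) m (BadRct m π)
    (by
      intro A B C hB hAB hBC
      have := hval B hB
      try dsimp only at *
      omega)
    (by
      rintro ⟨f, hf, hf2⟩
      choose d hd1 hd2 using fun i => (hf i).2
      refine h₂ (colayered_of_blocks π d hd1 ?_)
      intro a b hab i j
      have h3 := hf2 a b hab
      have h4 := hd2 a i
      have h5 := hd2 b j
      simp only [Fin.lt_def]
      try dsimp only at h3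
      omega)
  have hlines : ∀ i : Fin m × Fin m, ∃ x y z : ℕ,
      ∀ A ∈ {A | A ∈ BadRct m π ∧ L A = i.1 ∧ M A = i.2},
        (A.l ≤ x ∧ x ≤ A.r) ∨ (A.b ≤ y ∧ y ≤ A.t) ∨ (A.b ≤ z ∧ z ≤ A.t) := by
    intro i
    apply three_lines
    rintro A ⟨hA, hA1, hA2⟩ B ⟨hB, hB1, hB2⟩
    have h1 := hL2 A hA B hB
    have h2 := hL2 B hB A hA
    have h3 := hM2 A hA B hB
    have h4 := hM2 B hB A hA
    try dsimp only at h1 h2 h3 h4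
    omega
  choose X Y Z h using hlines
  refine ⟨X, Sum.elim Y Z, fun A hA => ?_⟩
  rcases h (⟨L A, hL1 A hA⟩, ⟨M A, hM1 A hA⟩) A ⟨hA, rfl, rfl⟩ with h | h | h
  · exact Or.inl ⟨_, h⟩
  · exact Or.inr ⟨Sum.inl _, h⟩
  · exact Or.inr ⟨Sum.inr _, h⟩

/-- Number of lines strictly below a coordinate. -/
def lineCount {ι : Type*} [Fintype ι] (X : ι → ℕ) (x : ℕ) : ℕ :=
  (Finset.univ.filter (fun i => X i < x)).card

theorem lineCount_mono {ι : Type*} [Fintype ι] (X : ι → ℕ) {x y : ℕ} (h : x ≤ y) :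
    lineCount X x ≤ lineCount X y := by
  apply Finset.card_le_card
  intro i
  simp only [Finset.mem_filter, Finset.mem_univ, true_and]
  omega

theorem lineCount_lt {ι : Type*} [Fintype ι] (X : ι → ℕ) {x y : ℕ} (i : ι) (h : x < X i)
    (h' : X i < y) : lineCount X x < lineCount X y := by
  apply Finset.card_lt_card
  rw [Finset.ssubset_iff_of_subset]
  · refine ⟨i, ?_, ?_⟩ <;> simp only [Finset.mem_filter, Finset.mem_univ, true_and] <;> omega
  · intro i
    simp only [Finset.mem_filter, Finset.mem_univ, true_and]
    omega

theorem lineCount_le {ι : Type*} [Fintype ι] (X : ι → ℕ) (x : ℕ) :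
    lineCount X x ≤ Fintype.card ι := Finset.card_le_univ _

theorem coloring {n m : ℕ} {ι κ : Type} [Fintype ι] [Fintype κ] (π : Equiv.Perm (Fin n))
    (X : ι → ℕ) (Y : κ → ℕ)
    (hXY : ∀ A ∈ BadRct m π, (∃ i, A.l ≤ X i ∧ X i ≤ A.r) ∨ (∃ i, A.b ≤ Y i ∧ Y i ≤ A.t)) :
    ∃ P : Fin n → (ι ⊕ κ) ⊕ (Bool × Fin (Fintype.card ι + Fintype.card κ + 1) × Fin m),
      ∀ c, (∀ i j : Fin n, P i = c → P j = c → i < j → π i < π j) ∨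
          (∀ i j : Fin n, P i = c → P j = c → i < j → π j < π i) := by
  classical
  let E : Fin n → Prop := fun p => (∃ i, X i = p) ∨ (∃ i, Y i = π p)
  let cc : Fin n → ℕ := fun p => lineCount X p
  let rr : Fin n → ℕ := fun p => lineCount Y (π p)
  let cell : ℕ × ℕ → Set (Fin n) := fun w => {p | ¬ E p ∧ cc p = w.1 ∧ rr p = w.2}
  let dec : Fin n → Fin n → Prop := fun p q => p < q ∧ π q < π p
  let inc : Fin n → Fin n → Prop := fun p q => p < q ∧ π p < π q
  let good : ℕ × ℕ → Prop := fun w =>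
    ¬ ∃ f : Fin (m + 1) → Fin n, (∀ i, f i ∈ cell w) ∧ ∀ i j, i < j → dec (f i) (f j)
  have hgood : ∀ w, ¬ good w →
    ¬ ∃ f : Fin (m + 1) → Fin n, (∀ i, f i ∈ cell w) ∧ ∀ i j, i < j → inc (f i) (f j) := by
    intro w hw
    rintro ⟨e, he1, he2⟩
    obtain ⟨d, hd1, hd2⟩ := not_not.1 hw
    have hne : (cell w).Nonempty := ⟨_, he1 0⟩
    have hfin : (cell w).Finite := Set.toFinite _
    obtain ⟨p1, hp1, hl⟩ := Set.exists_min_image (cell w) (fun p => (p : ℕ)) hfin hne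
    obtain ⟨p2, hp2, hr⟩ := Set.exists_max_image (cell w) (fun p => (p : ℕ)) hfin hne
    obtain ⟨p3, hp3, hb⟩ := Set.exists_min_image (cell w) (fun p => (π p : ℕ)) hfin hne
    obtain ⟨p4, hp4, ht⟩ := Set.exists_max_image (cell w) (fun p => (π p : ℕ)) hfin hne
    have hbad : (⟨p1, p2, π p3, π p4⟩ : Rct) ∈ BadRct m π :=
      ⟨⟨d, hd2, fun i => ⟨hl _ (hd1 i), hr _ (hd1 i), hb _ (hd1 i), ht _ (hd1 i)⟩⟩,
       ⟨e, he2, fun i => ⟨hl _ (he1 i), hr _ (he1 i), hb _ (he1 i), ht _ (he1 i)⟩⟩⟩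
    rcases hXY _ hbad with ⟨i, hi1, hi2⟩ | ⟨i, hi1, hi2⟩
    · dsimp only at hi1 hi2
      have n1 : X i ≠ p1 := fun h => hp1.1 (Or.inl ⟨i, h⟩)
      have n2 : X i ≠ p2 := fun h => hp2.1 (Or.inl ⟨i, h⟩)
      have := lineCount_lt X i (lt_of_le_of_ne hi1 n1.symm) (lt_of_le_of_ne hi2 n2)
      have e1 : lineCount X p1 = w.1 := hp1.2.1
      have e2 : lineCount X p2 = w.1 := hp2.2.1
      omega
    · dsimp only at hi1 hi2
      have n1 : Y i ≠ π p3 := fun h => hp3.1 (Or.inr ⟨i, h⟩)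
      have n2 : Y i ≠ π p4 := fun h => hp4.1 (Or.inr ⟨i, h⟩)
      have := lineCount_lt Y i (lt_of_le_of_ne hi1 n1.symm) (lt_of_le_of_ne hi2 n2)
      have e1 : lineCount Y (π p3) = w.2 := hp3.2.2
      have e2 : lineCount Y (π p4) = w.2 := hp4.2.2
      omega
  have hLd : ∀ w, ∃ L : Fin n → ℕ, good w → ((∀ a ∈ cell w, L a < m) ∧
      ∀ a ∈ cell w, ∀ b ∈ cell w, dec a b → L a < L b) := by
    intro w
    by_cases h : good w
    · obtain ⟨L, hL⟩ := levels_aux dec m (cell w)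
        (fun a b c _ h1 h2 => ⟨h1.1.trans h2.1, h2.2.trans h1.2⟩) h
      exact ⟨L, fun _ => hL⟩
    · exact ⟨fun _ => 0, fun h' => absurd h' h⟩
  have hLi : ∀ w, ∃ L : Fin n → ℕ, ¬ good w → ((∀ a ∈ cell w, L a < m) ∧
      ∀ a ∈ cell w, ∀ b ∈ cell w, inc a b → L a < L b) := by
    intro w
    by_cases h : good w
    · exact ⟨fun _ => 0, fun h' => absurd h h'⟩
    · obtain ⟨L, hL⟩ := levels_aux inc m (cell w)
        (fun a b c _ h1 h2 => ⟨h1.1.trans h2.1, h1.2.trans h2.2⟩) (hgood w h)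
      exact ⟨L, fun _ => hL⟩
  choose D hD using hLd
  choose I hI using hLi
  have hcc : ∀ p, cc p ≤ Fintype.card ι := fun p => lineCount_le X _
  have hrr : ∀ p, rr p ≤ Fintype.card κ := fun p => lineCount_le Y _
  have hccm : ∀ p q, cc p < cc q → p < q := by
    intro p q h
    by_contra hcon
    exact absurd (lineCount_mono X (show (q : ℕ) ≤ p by simpa using hcon)) (not_le.2 h)
  have hrrm : ∀ p q, rr p < rr q → π p < π q := by
    intro p q h
    by_contra hcon
    exact absurd (lineCount_mono Y (show (π q : ℕ) ≤ π p by simpa using hcon)) (not_le.2 h)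
  -- the specification of the colour of a point
  have hcol : ∀ p : Fin n, ∃ c : (ι ⊕ κ) ⊕ (Bool × Fin (Fintype.card ι + Fintype.card κ + 1) × Fin m),
      (∃ i, c = Sum.inl (Sum.inl i) ∧ X i = p) ∨ (∃ i, c = Sum.inl (Sum.inr i) ∧ Y i = π p) ∨
      (¬ E p ∧ good (cc p, rr p) ∧ ∃ u v, c = Sum.inr (true, u, v) ∧
        (u : ℕ) + rr p = cc p + Fintype.card κ ∧ (v : ℕ) = D (cc p, rr p) p) ∨
      (¬ E p ∧ ¬ good (cc p, rr p) ∧ ∃ u v, c = Sum.inr (false, u, v) ∧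
        (u : ℕ) = cc p + rr p ∧ (v : ℕ) = I (cc p, rr p) p) := by
    intro p
    have h1 := hcc p
    have h2 := hrr p
    by_cases hE : E p
    · rcases hE with ⟨i, hi⟩ | ⟨i, hi⟩
      · exact ⟨_, Or.inl ⟨i, rfl, hi⟩⟩
      · exact ⟨_, Or.inr (Or.inl ⟨i, rfl, hi⟩)⟩
    · by_cases hg : good (cc p, rr p)
      · exact ⟨Sum.inr (true, ⟨cc p + Fintype.card κ - rr p, by omega⟩,
          ⟨D (cc p, rr p) p, (hD _ hg).1 p ⟨hE, rfl, rfl⟩⟩),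
          Or.inr (Or.inr (Or.inl ⟨hE, hg, _, _, rfl, by dsimp only; omega, rfl⟩))⟩
      · exact ⟨Sum.inr (false, ⟨cc p + rr p, by omega⟩,
          ⟨I (cc p, rr p) p, (hI _ hg).1 p ⟨hE, rfl, rfl⟩⟩),
          Or.inr (Or.inr (Or.inr ⟨hE, hg, _, _, rfl, rfl, rfl⟩))⟩
  choose P hP using hcol
  refine ⟨P, ?_⟩
  rintro ((i | i) | ⟨_ | _, u, v⟩)
  · left
    intro p q hp hq hpq
    have h1 := hP p
    have h2 := hP q
    rw [hp] at h1
    rw [hq] at h2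
    simp at h1 h2
    have : (p : ℕ) < q := hpq
    omega
  · left
    intro p q hp hq hpq
    have h1 := hP p
    have h2 := hP q
    rw [hp] at h1
    rw [hq] at h2
    simp at h1 h2
    have : π p = π q := Fin.ext (h1.symm.trans h2)
    exact absurd (π.injective this) hpq.ne
  · right
    intro p q hp hq hpq
    have h1 := hP p
    have h2 := hP q
    rw [hp] at h1
    rw [hq] at h2
    simp only [reduceCtorEq, false_and, exists_false, false_or, and_false, Sum.inr.injEq,
      Prod.mk.injEq, true_and, Bool.true_eq_false, Bool.false_eq_true] at h1 h2
    obtain ⟨hE1, hg1, _, _, ⟨rfl, rfl⟩, hu1, hv1⟩ := h1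
    obtain ⟨hE2, hg2, _, _, ⟨rfl, rfl⟩, hu2, hv2⟩ := h2
    by_cases hc : cc p = cc q
    · have hr : rr p = rr q := by omega
      by_contra hcon
      have hne : π p ≠ π q := fun h => hpq.ne (π.injective h)
      have hlt : π p < π q := lt_of_le_of_ne (not_lt.1 hcon) hne
      have := (hI _ hg1).2 p ⟨hE1, rfl, rfl⟩ q ⟨hE2, hc.symm, hr.symm⟩ ⟨hpq, hlt⟩
      rw [← hc, ← hr] at hv2
      omega
    · have hm : cc p ≤ cc q := lineCount_mono X (show (p : ℕ) ≤ q from hpq.le)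
      exact hrrm _ _ (by omega)
  · left
    intro p q hp hq hpq
    have h1 := hP p
    have h2 := hP q
    rw [hp] at h1
    rw [hq] at h2
    simp only [reduceCtorEq, false_and, exists_false, false_or, or_false, and_false, Sum.inr.injEq,
      Prod.mk.injEq, true_and, Bool.true_eq_false, Bool.false_eq_true] at h1 h2
    obtain ⟨hE1, hg1, _, _, ⟨rfl, rfl⟩, hu1, hv1⟩ := h1
    obtain ⟨hE2, hg2, _, _, ⟨rfl, rfl⟩, hu2, hv2⟩ := h2
    by_cases hc : cc p = cc q
    · have hr : rr p = rr q := by omega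
      by_contra hcon
      have hne : π q ≠ π p := fun h => hpq.ne (π.injective h.symm)
      have hlt : π q < π p := lt_of_le_of_ne (not_lt.1 hcon) hne
      have := (hD _ hg1).2 p ⟨hE1, rfl, rfl⟩ q ⟨hE2, hc.symm, hr.symm⟩ ⟨hpq, hlt⟩
      rw [← hc, ← hr] at hv2
      omega
    · have hm : cc p ≤ cc q := lineCount_mono X (show (p : ℕ) ≤ q from hpq.le)
      exact hrrm _ _ (by omega)

/-- If every member of a permutation class avoids both `⊕^k(k...21)` and
`⊖^k(12...k)`, then every member is a merge of at most `8k³` monotone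
permutations: its index set can be partitioned into at most `8k³` parts, on
each of which it is strictly increasing or strictly decreasing. -/
theorem avoiding_class_merge_of_monotone (k : ℕ) (C : ∀ n : ℕ, Set (Equiv.Perm (Fin n)))
    (h₁ : ∀ (n : ℕ) (π : Equiv.Perm (Fin n)), π ∈ C n →
      ¬ ContainsPattern (LayeredFun k) π)
    (h₂ : ∀ (n : ℕ) (π : Equiv.Perm (Fin n)), π ∈ C n →
      ¬ ContainsPattern (ColayeredFun k) π) :
    ∀ (n : ℕ) (π : Equiv.Perm (Fin n)), π ∈ C n →
      ∃ P : Fin n → Fin (8 * k ^ 3),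
        ∀ c : Fin (8 * k ^ 3),
          (∀ i j : Fin n, P i = c → P j = c → i < j → π i < π j) ∨
          (∀ i j : Fin n, P i = c → P j = c → i < j → π j < π i) := by
  intro n π hπ
  rcases k with _ | m
  · exfalso
    refine h₁ n π hπ ⟨fun i => absurd i.2 (by simp), fun i => absurd i.2 (by simp),
      fun i => absurd i.2 (by simp)⟩
  obtain ⟨X, Y, hXY⟩ := bad_pierced π (h₁ n π hπ) (h₂ n π hπ)
  obtain ⟨P, hP⟩ := coloring π X Y hXY
  have hcard : Fintype.card (((Fin m × Fin m) ⊕ ((Fin m × Fin m) ⊕ (Fin m × Fin m))) ⊕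
      (Bool × Fin (Fintype.card (Fin m × Fin m) +
        Fintype.card ((Fin m × Fin m) ⊕ (Fin m × Fin m)) + 1) × Fin m)) ≤
      Fintype.card (Fin (8 * (m + 1) ^ 3)) := by
    simp only [Fintype.card_sum, Fintype.card_prod, Fintype.card_fin, Fintype.card_bool]
    nlinarith [Nat.zero_le m, Nat.zero_le (m * m), Nat.zero_le (m * m * m)]
  obtain ⟨e⟩ := Function.Embedding.nonempty_of_card_le hcard
  refine ⟨fun i => e (P i), fun c => ?_⟩
  by_cases hc : ∃ t, e t = c
  · obtain ⟨t, rfl⟩ := hc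
    simpa only [e.injective.eq_iff] using hP t
  · exact Or.inl fun i j hi => absurd ⟨_, hi⟩ hc
end
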